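/- arXiv:0704.0608 — 3 statements merged into one kernel-verified Lean document; each statement's English description precedes it below -/
import Mathlib

section
/- Let k be an infinite field, R = k[s,t], and let I ⊂ R be a height-2 ideal minimally generated by three forms of degree 5 whose Hilbert–Burch matrix has columns of degrees 1 and 4. In S = R[T_1, T_2, T_3], write the two defining equations of Sym(I) as f = a s + b t and g = c s + d t, where a, b are k-linear forms in T_1, T_2, T_3 and c = x_1 s^3 + x_2 s^2 t + x_3 s t^2 + x_4 t^3, d = y_1 s^3 + y_2 s^2 t + y_3 s t^2 + y_4 t^3 with x_i, y_i k-linear forms in T_1, T_2, T_3. Set h_1 = ad − bc and, inductively, h_{i+1} = det(f, h_i)_{(s,t)} for i = 1, 2, 3 (the Sylvester form obtained by writing h_i = A s + B t with A, B the evident coefficients and setting h_{i+1} = aB − bA). Then the defining ideal of the Rees algebra R[It] in S equals (f, g, h_1, h_2, h_3, h_4), and h_4 is the elimination equation. -/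
open MvPolynomial

/-- The height of an ideal: the infimum of the heights of the prime ideals containing it. -/
noncomputable def Ideal.heightOf {R : Type*} [CommRing R] (I : Ideal R) : ℕ∞ :=
  ⨅ (P : PrimeSpectrum R) (_ : I ≤ P.asIdeal), Order.height P

/-- The `k`-algebra map `k[s,t,T₁,T₂,T₃] → k[s,t][T]` sending `s ↦ s`, `t ↦ t` and the
variables `T₁, T₂, T₃` to `f₁T, f₂T, f₃T`.  Its kernel is the defining ideal of the Rees
algebra `R[It]`, `I = (f₁,f₂,f₃)`, presented over `S = R[T₁,T₂,T₃] ≅ k[s,t,T₁,T₂,T₃]`. -/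
noncomputable def reesPresentation (k : Type*) [CommRing k]
    (f : Fin 3 → MvPolynomial (Fin 2) k) :
    MvPolynomial (Fin 5) k →ₐ[k] Polynomial (MvPolynomial (Fin 2) k) :=
  MvPolynomial.aeval
    ![Polynomial.C (X 0), Polynomial.C (X 1),
      Polynomial.C (f 0) * Polynomial.X, Polynomial.C (f 1) * Polynomial.X,
      Polynomial.C (f 2) * Polynomial.X]

/-- The embedding `k[T₁,T₂,T₃] → k[s,t,T₁,T₂,T₃]`. -/
noncomputable def toFive (k : Type*) [CommRing k] :
    MvPolynomial (Fin 3) k →ₐ[k] MvPolynomial (Fin 5) k :=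
  MvPolynomial.rename (Fin.natAdd 2)

/-- Substitution `s ↦ 0` on `k[s,t,T₁,T₂,T₃]`; used to single out the "pure `t`" part of a
polynomial when writing it as `As + Bt` with evident coefficients. -/
noncomputable def setSZero (k : Type*) [CommRing k] :
    MvPolynomial (Fin 5) k →ₐ[k] MvPolynomial (Fin 5) k :=
  MvPolynomial.aeval (fun i => if i = 0 then 0 else X i)

/-- The kernel of a homomorphism `D[z] → C` that is injective on `D` and kills a primitive linear
polynomial `p z + q` is generated by that polynomial. -/
theorem Polynomial.C_mul_X_add_C_dvd_of_map_eq_zero {D C' : Type*} [CommRing D] [IsDomain D]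
    [UniqueFactorizationMonoid D] [CommRing C'] [IsDomain C'] {p q : D} (hp : p ≠ 0)
    (hpq : IsRelPrime p q) (θ : Polynomial D →+* C')
    (hinj : ∀ r, θ (Polynomial.C r) = 0 → r = 0)
    (hroot : θ (Polynomial.C p * Polynomial.X + Polynomial.C q) = 0)
    {P : Polynomial D} (hP : θ P = 0) :
    Polynomial.C p * Polynomial.X + Polynomial.C q ∣ P := by
  have hprime : Prime (Polynomial.C p * Polynomial.X + Polynomial.C q) :=
    (Polynomial.irreducible_C_mul_X_add_C hp hpq).prime
  have key : ∀ P : Polynomial D, ∃ N r, Polynomial.C p * Polynomial.X + Polynomial.C q ∣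
      Polynomial.C (p ^ N) * P - Polynomial.C r := by
    intro P
    induction P using Polynomial.induction_on with
    | C a => exact ⟨0, a, by simp⟩
    | add P Q hP hQ =>
      obtain ⟨N, r, u, hu⟩ := hP
      obtain ⟨N', r', u', hu'⟩ := hQ
      refine ⟨N + N', p ^ N' * r + p ^ N * r',
        Polynomial.C (p ^ N') * u + Polynomial.C (p ^ N) * u', ?_⟩
      simp only [map_add, map_mul, pow_add] at *
      linear_combination Polynomial.C (p ^ N') * hu + Polynomial.C (p ^ N) * hu'
    | monomial n a h =>
      obtain ⟨N, r, u, hu⟩ := h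
      refine ⟨N + 1, - q * r, Polynomial.C p * Polynomial.X * u + Polynomial.C r, ?_⟩
      simp only [map_add, map_mul, pow_add, map_neg, pow_one] at *
      linear_combination Polynomial.C p * Polynomial.X * hu
  obtain ⟨N, r, hu⟩ := key P
  have hr : r = 0 := by
    apply hinj
    obtain ⟨u, hu⟩ := hu
    have := congrArg θ hu
    rw [map_mul θ, hroot, map_sub, map_mul, hP] at this
    simpa using this
  rw [hr, map_zero, sub_zero] at hu
  refine (hprime.dvd_or_dvd hu).resolve_left fun h => ?_
  have h1 := Polynomial.natDegree_le_of_dvd h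
    (by rw [Ne, Polynomial.C_eq_zero]; exact pow_ne_zero _ hp)
  rw [Polynomial.natDegree_linear hp, Polynomial.natDegree_C] at h1
  omega

/-- A common divisor of the elements of an ideal of height two is a unit. -/
theorem Ideal.isUnit_of_dvd_of_heightOf_eq_two {A : Type*} [CommRing A] [IsNoetherianRing A]
    {I : Ideal A} (hI : I.heightOf = 2) {d : A} (hd : ∀ x ∈ I, d ∣ x) : IsUnit d := by
  by_contra h
  obtain ⟨m, hm, hdm⟩ := exists_max_ideal_of_mem_nonunits h
  obtain ⟨p, hp, -⟩ := Ideal.exists_minimalPrimes_le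
    ((Ideal.span_singleton_le_iff_mem m).2 hdm)
  have hpp : p.IsPrime := hp.1.1
  have h1 := Ideal.height_le_one_of_isPrincipal_of_mem_minimalPrimes (Ideal.span {d}) p hp
  have h2 : I.heightOf ≤ Order.height (⟨p, hpp⟩ : PrimeSpectrum A) := by
    refine iInf₂_le (⟨p, hpp⟩ : PrimeSpectrum A) fun x hx => hp.1.2 ?_
    exact Ideal.mem_span_singleton.2 (hd x hx)
  rw [← PrimeSpectrum.height_eq_orderHeight, hI] at h2
  exact absurd (h2.trans h1) (by decide)

/-- A form of degree `n` scales with the factor `v ^ n`. -/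
theorem MvPolynomial.IsHomogeneous.aeval_mul_right {k σ A : Type*} [CommSemiring k]
    [CommSemiring A] [Algebra k A] {P : MvPolynomial σ k} {n : ℕ} (hP : P.IsHomogeneous n)
    (y : σ → A) (v : A) :
    MvPolynomial.aeval (fun i => y i * v) P = v ^ n * MvPolynomial.aeval y P := by
  rw [aeval_def, aeval_def, eval₂_eq, eval₂_eq, Finset.mul_sum]
  refine Finset.sum_congr rfl fun e he => ?_
  have hd : ∑ i ∈ e.support, e i = n := by
    have := hP (mem_support_iff.1 he)
    simpa [Finsupp.weight_apply, Finsupp.sum] using this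
  simp only [mul_pow, Finset.prod_mul_distrib, Finset.prod_pow_eq_pow_sum, hd]
  ring

/-- Substituting `x ↦ x m`, `y ↦ y m` for a nonzero form `m` is injective on `k[x,y]`. -/
theorem MvPolynomial.eq_zero_of_aeval_X_mul_eq_zero {k σ : Type*} [Field k]
    {m : MvPolynomial σ k} {n : ℕ} (hm : m.IsHomogeneous n) (hm0 : m ≠ 0)
    {P : MvPolynomial σ k} (hP : aeval (fun i => X i * m) P = 0) : P = 0 := by
  have hom : ∀ (d : ℕ) (Q : MvPolynomial σ k), Q.IsHomogeneous d →
      aeval (fun i => X i * m) Q = m ^ d * Q := fun d Q hQ => by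
    rw [hQ.aeval_mul_right, aeval_X_left_apply]
  rw [← sum_homogeneousComponent P, map_sum,
    Finset.sum_congr rfl fun d _ => hom d _ (homogeneousComponent_isHomogeneous d P)] at hP
  rw [← sum_homogeneousComponent P]
  refine Finset.sum_eq_zero fun d hd => ?_
  have h2 : ∀ j, (m ^ j * homogeneousComponent j P).IsHomogeneous (n * j + j) := fun j =>
    (hm.pow j).mul (homogeneousComponent_isHomogeneous j P)
  have h3 := congrArg (homogeneousComponent (n * d + d)) hP
  rw [map_sum, map_zero, Finset.sum_eq_single d] at h3
  · rw [homogeneousComponent_of_mem (h2 d), if_pos rfl] at h3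
    exact (mul_eq_zero.1 h3).resolve_left (pow_ne_zero _ hm0)
  · intro j _ hj
    rw [homogeneousComponent_of_mem (h2 j), if_neg]
    intro h
    apply hj
    nlinarith [lt_trichotomy j d]
  · exact fun h => absurd hd h

/-- The linear form with coefficient vector `v`. -/
noncomputable def linForm {k : Type*} [CommRing k] (v : Fin 3 → k) : MvPolynomial (Fin 3) k :=
  ∑ i, C (v i) * X i

theorem linForm_add {k : Type*} [CommRing k] (v w : Fin 3 → k) :
    linForm (v + w) = linForm v + linForm w := by
  simp [linForm, add_mul, Finset.sum_add_distrib]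

theorem linForm_smul {k : Type*} [CommRing k] (r : k) (v : Fin 3 → k) :
    linForm (r • v) = C r * linForm v := by
  simp [linForm, mul_assoc, Finset.mul_sum]

theorem linForm_coeff_of_mem_span {k : Type*} [CommRing k] {p : MvPolynomial (Fin 3) k}
    (hp : p ∈ Submodule.span k (Set.range (X : Fin 3 → MvPolynomial (Fin 3) k))) :
    linForm (fun i => coeff (Finsupp.single i 1) p) = p := by
  induction hp using Submodule.span_induction with
  | mem x hx =>
    obtain ⟨j, rfl⟩ := hx
    rw [linForm, Finset.sum_eq_single j] <;>
      simp +contextual [coeff_X, Finsupp.single_left_inj, eq_comm]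
  | zero => simp [linForm]
  | add x y _ _ hx hy =>
    conv_rhs => rw [← hx, ← hy, ← linForm_add]
    rfl
  | smul r x _ hx =>
    conv_rhs => rw [← hx, smul_eq_C_mul, ← linForm_smul]
    rfl

theorem sum_inv_mul_linForm {k : Type*} [Field k] {M : Matrix (Fin 3) (Fin 3) k}
    (hM : M.det ≠ 0) (i : Fin 3) :
    ∑ j, C (M⁻¹ i j) * linForm (M j) = X i := by
  have h : M⁻¹ * M = 1 := Matrix.nonsing_inv_mul M (isUnit_iff_ne_zero.2 hM)
  simp only [linForm, Finset.mul_sum, ← mul_assoc, ← C_mul]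
  rw [Finset.sum_comm]
  simp only [← Finset.sum_mul, ← map_sum]
  have h2 : ∀ l, ∑ j, M⁻¹ i j * M j l = (1 : Matrix (Fin 3) (Fin 3) k) i l := fun l => by
    rw [← h, Matrix.mul_apply]
  simp [h2, Matrix.one_apply]

theorem eq_sum_vecMul_inv {k : Type*} [Field k] {M : Matrix (Fin 3) (Fin 3) k}
    (hM : M.det ≠ 0) (v : Fin 3 → k) :
    v = (Matrix.vecMul v M⁻¹) 0 • M 0 + (Matrix.vecMul v M⁻¹) 1 • M 1 +
      (Matrix.vecMul v M⁻¹) 2 • M 2 := by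
  have h : M⁻¹ * M = 1 := Matrix.nonsing_inv_mul M (isUnit_iff_ne_zero.2 hM)
  have h2 : Matrix.vecMul (Matrix.vecMul v M⁻¹) M = v := by
    rw [Matrix.vecMul_vecMul, h, Matrix.vecMul_one]
  ext l
  conv_lhs => rw [← h2]
  simp only [Matrix.vecMul, dotProduct, Fin.sum_univ_three, Pi.add_apply, Pi.smul_apply,
    smul_eq_mul]

/-- The coordinates `M 0, M 1, M 2` can be sent to arbitrary elements of an algebra. -/
theorem exists_algHom_linForm {k A : Type*} [Field k] [CommRing A] [Algebra k A]
    {M : Matrix (Fin 3) (Fin 3) k} (hM : M.det ≠ 0) (c : Fin 3 → A) :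
    ∃ θ : MvPolynomial (Fin 3) k →ₐ[k] A, (∀ l, θ (linForm (M l)) = c l) ∧
      ∀ i, θ (X i) = ∑ j, algebraMap k A (M⁻¹ i j) * c j := by
  have h : M * M⁻¹ = 1 := Matrix.mul_nonsing_inv M (isUnit_iff_ne_zero.2 hM)
  have h2 : ∀ l r, ∑ j, M l j * M⁻¹ j r = (1 : Matrix (Fin 3) (Fin 3) k) l r := fun l r => by
    rw [← h, Matrix.mul_apply]
  refine ⟨aeval fun i => ∑ j, algebraMap k A (M⁻¹ i j) * c j, fun l => ?_, fun i => aeval_X _ i⟩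
  simp only [linForm, map_sum, map_mul, aeval_C, aeval_X, Finset.mul_sum, ← mul_assoc]
  rw [Finset.sum_comm]
  simp only [← Finset.sum_mul, ← map_mul, ← map_sum, h2]
  simp [Matrix.one_apply]

/-- Linear coordinates on `k[T₁,T₂,T₃]`, with the first two taken to be `-b` and `a`. -/
theorem exists_algEquiv_linForm {k : Type*} [Field k] {M : Matrix (Fin 3) (Fin 3) k}
    (hM : M.det ≠ 0) :
    ∃ ρ : Polynomial (MvPolynomial (Fin 2) k) ≃ₐ[k] MvPolynomial (Fin 3) k,
      ρ (Polynomial.C (X 0)) = -linForm (M 1) ∧ ρ (Polynomial.C (X 1)) = linForm (M 0) ∧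
      ρ Polynomial.X = linForm (M 2) := by
  let F : Polynomial (MvPolynomial (Fin 2) k) →ₐ[k] MvPolynomial (Fin 3) k :=
    Polynomial.eval₂AlgHom (aeval ![-linForm (M 1), linForm (M 0)]) (linForm (M 2))
      fun _ => mul_comm _ _
  obtain ⟨G, hGl, -⟩ := exists_algHom_linForm hM
    (![Polynomial.C (X 1), -Polynomial.C (X 0 : MvPolynomial (Fin 2) k), Polynomial.X] :
      Fin 3 → Polynomial (MvPolynomial (Fin 2) k))
  have hF0 : F (Polynomial.C (X 0)) = -linForm (M 1) := by simp [F]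
  have hF1 : F (Polynomial.C (X 1)) = linForm (M 0) := by simp [F]
  have hFX : F Polynomial.X = linForm (M 2) := by simp [F]
  have hFG : ∀ l, F (G (linForm (M l))) = linForm (M l) := by
    intro l
    rw [hGl]
    fin_cases l
    · exact hF1
    · change F (-Polynomial.C (X 0 : MvPolynomial (Fin 2) k)) = _
      rw [map_neg, hF0, neg_neg]; rfl
    · exact hFX
  refine ⟨AlgEquiv.ofAlgHom F G ?_ ?_, hF0, hF1, hFX⟩
  · refine MvPolynomial.algHom_ext fun i => ?_
    rw [AlgHom.id_apply, AlgHom.comp_apply, ← sum_inv_mul_linForm hM i]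
    simp only [map_sum, map_mul, hFG, ← algebraMap_eq, AlgHom.commutes]
  · refine Polynomial.algHom_ext' (MvPolynomial.algHom_ext fun i => ?_) ?_
    · fin_cases i
      · change G (F (Polynomial.C (X 0))) = Polynomial.C (X 0)
        rw [hF0, map_neg, hGl]; simp
      · change G (F (Polynomial.C (X 1))) = Polynomial.C (X 1)
        rw [hF1, hGl]; simp
    · change G (F Polynomial.X) = Polynomial.X
      rw [hFX, hGl]; simp

/-- If a degree-tracking homomorphism `θ : B → B[w]` sends `e` to `w ^ d` times a polynomial with
nonzero constant term, then `e` has order exactly `d` in the associated graded ring of `J`. -/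
theorem mem_pow_of_mul_mem_pow {k σ : Type*} [Field k] {J : Ideal (MvPolynomial σ k)}
    (θ : MvPolynomial σ k →ₐ[k] Polynomial (MvPolynomial σ k))
    (hrees : ∀ i, θ (X i) ∈ reesAlgebra J) (heval : ∀ i, (θ (X i)).eval 1 = X i)
    (hJ : ∀ x ∈ J, Polynomial.X ∣ θ x) {e : MvPolynomial σ k}
    {e' : Polynomial (MvPolynomial σ k)} {d : ℕ} (he : θ e = Polynomial.X ^ d * e')
    (he' : e'.coeff 0 ≠ 0) {n : ℕ} {r : MvPolynomial σ k} (hr : e * r ∈ J ^ (d + n)) :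
    r ∈ J ^ n := by
  have hrees' : ∀ P, θ P ∈ reesAlgebra J := by
    intro P
    induction P using MvPolynomial.induction_on with
    | C a =>
      rw [← algebraMap_eq, AlgHom.commutes,
        IsScalarTower.algebraMap_apply k (MvPolynomial σ k) (Polynomial (MvPolynomial σ k))]
      exact Subalgebra.algebraMap_mem _ _
    | add p q hp hq => rw [map_add]; exact add_mem hp hq
    | mul_X p i hp => rw [map_mul]; exact mul_mem hp (hrees i)
  have heval' : ∀ P, (θ P).eval 1 = P := by
    intro P
    induction P using MvPolynomial.induction_on with
    | C a =>
      rw [← algebraMap_eq, AlgHom.commutes,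
        IsScalarTower.algebraMap_apply k (MvPolynomial σ k) (Polynomial (MvPolynomial σ k)),
        Polynomial.algebraMap_eq, Polynomial.eval_C]
    | add p q hp hq => rw [map_add, Polynomial.eval_add, hp, hq]
    | mul_X p i hp => rw [map_mul, Polynomial.eval_mul, hp, heval]
  have hdvd : ∀ n, ∀ x ∈ J ^ n, Polynomial.X ^ n ∣ θ x := by
    intro n x hx
    have h1 : J ≤ (Ideal.span {Polynomial.X}).comap θ := fun x hx =>
      Ideal.mem_span_singleton.2 (hJ x hx)
    have h2 := (Ideal.pow_right_mono h1 n).trans (Ideal.le_comap_pow θ n) hx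
    rwa [Ideal.mem_comap, Ideal.span_singleton_pow, Ideal.mem_span_singleton] at h2
  have h1 := hdvd _ _ hr
  rw [map_mul, he, pow_add, mul_assoc] at h1
  have h2 := (mul_dvd_mul_iff_left (pow_ne_zero d Polynomial.X_ne_zero)).1 h1
  have h3 := Polynomial.prime_X.pow_dvd_of_dvd_mul_left n
    (fun h => he' (Polynomial.X_dvd_iff.1 h)) h2
  rw [← heval' r, Polynomial.eval_eq_sum_range]
  refine Ideal.sum_mem _ fun i _ => ?_
  rw [one_pow, mul_one]
  by_cases hi : i < n
  · rw [Polynomial.X_pow_dvd_iff.1 h3 i hi]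
    exact zero_mem _
  · exact Ideal.pow_le_pow_right (not_lt.1 hi) ((mem_reesAlgebra_iff J _).1 (hrees' r) i)

/-- The binary quartic form with the given coefficients. -/
noncomputable def quartic {k : Type*} [CommRing k] (α : Fin 5 → k) : MvPolynomial (Fin 2) k :=
  ∑ j, C (α j) * (X 0 ^ (4 - (j : ℕ)) * X 1 ^ (j : ℕ))

theorem quartic_isHomogeneous {k : Type*} [CommRing k] (α : Fin 5 → k) :
    (quartic α).IsHomogeneous 4 := by
  refine IsHomogeneous.sum _ _ _ fun j _ => ?_
  have h := ((isHomogeneous_X_pow (R := k) (0 : Fin 2) (4 - (j : ℕ))).mul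
    (isHomogeneous_X_pow (R := k) (1 : Fin 2) (j : ℕ)))
  rw [show 4 - (j : ℕ) + j = 4 by omega] at h
  simpa using (isHomogeneous_C (Fin 2) (α j)).mul h

/-- The value at `(s, t) = (-b, a)` of the quartic with coefficients the linear forms `w j`. -/
noncomputable def implicitForm {k : Type*} [CommRing k] (M : Matrix (Fin 3) (Fin 3) k)
    (w : Fin 5 → Fin 3 → k) : MvPolynomial (Fin 3) k :=
  ∑ j, linForm (w j) * ((-linForm (M 1)) ^ (4 - (j : ℕ)) * linForm (M 0) ^ (j : ℕ))

section Core

variable {k : Type*} [Field k] {M : Matrix (Fin 3) (Fin 3) k} {w : Fin 5 → Fin 3 → k}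
  {α β γ : Fin 5 → k} {f : Fin 3 → MvPolynomial (Fin 2) k} {δ : k}

theorem isRelPrime_of_heightOf_eq_two (hM : M.det ≠ 0)
    (hfa : aeval f (linForm (M 0)) = X 1 * (C δ * quartic γ))
    (hfb : aeval f (linForm (M 1)) = -(X 0 * (C δ * quartic γ)))
    (hfc : aeval f (linForm (M 2)) = C δ * (X 0 * quartic β - X 1 * quartic α))
    (hht : (Ideal.span (Set.range f)).heightOf = 2) :
    IsRelPrime (quartic γ) (-(X 0 * quartic β - X 1 * quartic α)) := by
  intro d hd1 hd2
  refine Ideal.isUnit_of_dvd_of_heightOf_eq_two hht fun x hx => ?_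
  rw [← Ideal.mem_span_singleton]
  revert x
  change Ideal.span (Set.range f) ≤ _
  rw [Ideal.span_le]
  rintro _ ⟨i, rfl⟩
  rw [SetLike.mem_coe, Ideal.mem_span_singleton, ← aeval_X (R := k) f i,
    ← sum_inv_mul_linForm hM i, map_sum]
  refine Finset.dvd_sum fun j _ => ?_
  rw [map_mul]
  refine Dvd.dvd.mul_left ?_ _
  have h2 := (dvd_neg.1 hd2)
  fin_cases j
  · exact hfa ▸ (hd1.mul_left _).mul_left _
  · exact hfb ▸ ((hd1.mul_left _).mul_left _).neg_right
  · exact hfc ▸ h2.mul_left _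

theorem quartic_ne_zero_of_isRelPrime
    (h : IsRelPrime (quartic γ) (-(X 0 * quartic β - X 1 * quartic α))) : quartic γ ≠ 0 := by
  intro h0
  rw [h0, isRelPrime_zero_left] at h
  have h1 := h.map (constantCoeff (R := k) (σ := Fin 2))
  simp at h1

theorem implicitForm_eq (ρ : Polynomial (MvPolynomial (Fin 2) k) ≃ₐ[k] MvPolynomial (Fin 3) k)
    (hρ0 : ρ (Polynomial.C (X 0)) = -linForm (M 1))
    (hρ1 : ρ (Polynomial.C (X 1)) = linForm (M 0))
    (hρX : ρ Polynomial.X = linForm (M 2))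
    (hw : ∀ j, w j = α j • M 0 + β j • M 1 + γ j • M 2) :
    implicitForm M w = ρ (Polynomial.C (quartic γ) * Polynomial.X +
      Polynomial.C (-(X 0 * quartic β - X 1 * quartic α))) := by
  have hρC : ∀ r : k, ρ (Polynomial.C (C r)) = C r := fun r => ρ.commutes r
  simp only [implicitForm, hw, linForm_add, linForm_smul, quartic, Fin.sum_univ_five, map_add,
    map_mul, map_pow, map_neg, map_sub, hρ0, hρ1, hρX, hρC]
  ring

theorem ker_aeval_eq_span_implicitForm (hM : M.det ≠ 0) (hδ : δ ≠ 0)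
    (hw : ∀ j, w j = α j • M 0 + β j • M 1 + γ j • M 2)
    (hfa : aeval f (linForm (M 0)) = X 1 * (C δ * quartic γ))
    (hfb : aeval f (linForm (M 1)) = -(X 0 * (C δ * quartic γ)))
    (hfc : aeval f (linForm (M 2)) = C δ * (X 0 * quartic β - X 1 * quartic α))
    (hrel : IsRelPrime (quartic γ) (-(X 0 * quartic β - X 1 * quartic α))) :
    RingHom.ker (aeval f : MvPolynomial (Fin 3) k →ₐ[k] MvPolynomial (Fin 2) k) =
      Ideal.span {implicitForm M w} := by
  obtain ⟨ρ, hρ0, hρ1, hρX⟩ := exists_algEquiv_linForm hM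
  have hγ := quartic_ne_zero_of_isRelPrime hrel
  rw [implicitForm_eq ρ hρ0 hρ1 hρX hw]
  have hC : ∀ P, aeval f (ρ (Polynomial.C P)) = aeval (fun i => X i * (C δ * quartic γ)) P := by
    have : ((aeval f).comp ρ.toAlgHom).comp (Polynomial.CAlgHom (R := k)) =
        aeval (fun i => X i * (C δ * quartic γ)) := by
      refine MvPolynomial.algHom_ext fun i => ?_
      rw [aeval_X]
      fin_cases i
      · change aeval f (ρ (Polynomial.C (X 0))) = _
        rw [hρ0, map_neg, hfb, neg_neg]; rfl
      · change aeval f (ρ (Polynomial.C (X 1))) = _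
        rw [hρ1, hfa]; rfl
    exact fun P => DFunLike.congr_fun this P
  have hCd : (C δ : MvPolynomial (Fin 2) k) ≠ 0 := by simpa using hδ
  have hm : (C δ * quartic γ).IsHomogeneous 4 := by
    simpa using (isHomogeneous_C (Fin 2) δ).mul (quartic_isHomogeneous γ)
  have hroot : aeval f (ρ (Polynomial.C (quartic γ) * Polynomial.X +
      Polynomial.C (-(X 0 * quartic β - X 1 * quartic α)))) = 0 := by
    have h5 : ∀ κ : Fin 5 → k, aeval (fun i => X i * (C δ * quartic γ)) (quartic κ) =
        (C δ * quartic γ) ^ 4 * quartic κ := fun κ => by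
      rw [(quartic_isHomogeneous κ).aeval_mul_right, aeval_X_left_apply]
    rw [map_add, map_add, map_mul, map_mul, hC, hC, hρX, hfc]
    simp only [map_neg, map_sub, map_mul, h5, aeval_X]
    ring
  apply le_antisymm
  · intro P hP
    obtain ⟨P, rfl⟩ := ρ.surjective P
    rw [Ideal.mem_span_singleton]
    refine map_dvd ρ (Polynomial.C_mul_X_add_C_dvd_of_map_eq_zero hγ hrel
      ((aeval f).toRingHom.comp ρ.toAlgHom.toRingHom) (fun r hr => ?_) hroot hP)
    exact eq_zero_of_aeval_X_mul_eq_zero hm (mul_ne_zero hCd hγ) ((hC r).symm.trans hr)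
  · rw [Ideal.span_singleton_le_iff_mem]
    exact hroot

theorem mem_pow_of_implicitForm_mul_mem_pow (hM : M.det ≠ 0)
    (hw : ∀ j, w j = α j • M 0 + β j • M 1 + γ j • M 2) (hγ : quartic γ ≠ 0) {n : ℕ}
    {r : MvPolynomial (Fin 3) k}
    (hr : implicitForm M w * r ∈ Ideal.span {linForm (M 0), linForm (M 1)} ^ (4 + n)) :
    r ∈ Ideal.span {linForm (M 0), linForm (M 1)} ^ n := by
  obtain ⟨ρ, hρ0, hρ1, hρX⟩ := exists_algEquiv_linForm hM
  obtain ⟨θ, hθ, hθX⟩ := exists_algHom_linForm hM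
    (![Polynomial.C (linForm (M 0)) * Polynomial.X, Polynomial.C (linForm (M 1)) * Polynomial.X,
      Polynomial.C (linForm (M 2))] : Fin 3 → Polynomial (MvPolynomial (Fin 3) k))
  have hθ0 := hθ 0
  have hθ1 := hθ 1
  have hθ2 := hθ 2
  simp only [Matrix.cons_val_zero, Matrix.cons_val_one, Matrix.cons_val] at hθ0 hθ1 hθ2
  have hθC : ∀ r : k, θ (C r) = Polynomial.C (C r) := fun r => θ.commutes r
  refine mem_pow_of_mul_mem_pow θ (fun i => ?_) (fun i => ?_) (fun x hx => ?_)
    (e' := ∑ j, (Polynomial.C (C (γ j) * linForm (M 2)) +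
      Polynomial.X * Polynomial.C (C (α j) * linForm (M 0) + C (β j) * linForm (M 1))) *
      Polynomial.C ((-linForm (M 1)) ^ (4 - (j : ℕ)) * linForm (M 0) ^ (j : ℕ))) ?_ ?_ hr
  · rw [hθX]
    refine sum_mem fun j _ => mul_mem
      (Subalgebra.algebraMap_mem _ (C (M⁻¹ i j) : MvPolynomial (Fin 3) k)) ?_
    fin_cases j
    · change Polynomial.C (linForm (M 0)) * Polynomial.X ∈ _
      rw [Polynomial.C_mul_X_eq_monomial, reesAlgebra.monomial_mem, pow_one]
      exact Ideal.subset_span (by simp)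
    · change Polynomial.C (linForm (M 1)) * Polynomial.X ∈ _
      rw [Polynomial.C_mul_X_eq_monomial, reesAlgebra.monomial_mem, pow_one]
      exact Ideal.subset_span (by simp)
    · exact Subalgebra.algebraMap_mem _ (linForm (M 2))
  · conv_rhs => rw [← sum_inv_mul_linForm hM i]
    rw [hθX, Fin.sum_univ_three, Fin.sum_univ_three]
    simp only [Matrix.cons_val_zero, Matrix.cons_val_one, Matrix.cons_val,
      Polynomial.eval_add, Polynomial.eval_mul, Polynomial.eval_C, Polynomial.eval_X, mul_one]
    have : ∀ r : k, (algebraMap k (Polynomial (MvPolynomial (Fin 3) k)) r).eval 1 = C r :=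
      fun r => Polynomial.eval_C
    simp only [this]
  · obtain ⟨u, v, rfl⟩ := Ideal.mem_span_pair.1 hx
    rw [map_add, map_mul, map_mul, hθ0, hθ1]
    exact ⟨θ u * Polynomial.C (linForm (M 0)) + θ v * Polynomial.C (linForm (M 1)), by ring⟩
  · simp only [implicitForm, map_sum, Finset.mul_sum]
    refine Finset.sum_congr rfl fun j _ => ?_
    have hX : (Polynomial.X : Polynomial (MvPolynomial (Fin 3) k)) ^ 4 =
        Polynomial.X ^ (4 - (j : ℕ)) * Polynomial.X ^ (j : ℕ) := by
      rw [← pow_add]; congr 1; omega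
    simp only [hw, linForm_add, linForm_smul, map_add, map_mul, map_pow, map_neg, hθ0, hθ1, hθ2,
      hθC, hX]
    ring
  · have h1 : (∑ j, (Polynomial.C (C (γ j) * linForm (M 2)) +
        Polynomial.X * Polynomial.C (C (α j) * linForm (M 0) + C (β j) * linForm (M 1))) *
        Polynomial.C ((-linForm (M 1)) ^ (4 - (j : ℕ)) * linForm (M 0) ^ (j : ℕ))).coeff 0 =
        ρ (Polynomial.X * Polynomial.C (quartic γ)) := by
      have hρC : ∀ r : k, ρ (Polynomial.C (C r)) = C r := fun r => ρ.commutes r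
      simp only [quartic, Polynomial.coeff_zero_eq_eval_zero, Polynomial.eval_finsetSum,
        Polynomial.eval_mul, Polynomial.eval_pow, Polynomial.eval_add, Polynomial.eval_C,
        Polynomial.eval_X, map_mul,
        map_sum, map_pow, hρX, hρC, hρ0, hρ1, Finset.mul_sum]
      refine Finset.sum_congr rfl fun j _ => ?_
      ring
    rw [h1, Ne, EmbeddingLike.map_eq_zero_iff]
    exact mul_ne_zero Polynomial.X_ne_zero (Polynomial.C_ne_zero.2 hγ)

end Core

/-- The substitution `s ↦ -b u`, `t ↦ a u` parametrizing the zeros of `a s + b t`. -/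
noncomputable def rootSubst {k : Type*} [CommRing k] (a b : MvPolynomial (Fin 3) k) :
    MvPolynomial (Fin 5) k →ₐ[k] Polynomial (MvPolynomial (Fin 3) k) :=
  aeval ![-(Polynomial.C b * Polynomial.X), Polynomial.C a * Polynomial.X,
    Polynomial.C (X 0), Polynomial.C (X 1), Polynomial.C (X 2)]

section RootSubst

variable {k : Type*} [Field k] {a b : MvPolynomial (Fin 3) k}

theorem rootSubst_X_zero : rootSubst a b (X 0) = -(Polynomial.C b * Polynomial.X) := by
  simp [rootSubst]

theorem rootSubst_X_one : rootSubst a b (X 1) = Polynomial.C a * Polynomial.X := by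
  simp [rootSubst]

theorem rootSubst_toFive (p : MvPolynomial (Fin 3) k) :
    rootSubst a b (toFive k p) = Polynomial.C p := by
  have : (rootSubst a b).comp (toFive k) = Polynomial.CAlgHom (R := k) := by
    refine MvPolynomial.algHom_ext fun i => ?_
    rw [AlgHom.comp_apply, toFive, rename_X, rootSubst, aeval_X]
    fin_cases i <;> rfl
  exact DFunLike.congr_fun this p

theorem dvd_of_rootSubst_eq_zero (ha : Prime a) (hab : ¬ a ∣ b) {P : MvPolynomial (Fin 5) k}
    (hP : rootSubst a b P = 0) : toFive k a * X 0 + toFive k b * X 1 ∣ P := by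
  let ι₁ : Polynomial (MvPolynomial (Fin 3) k) →ₐ[k] MvPolynomial (Fin 5) k :=
    Polynomial.eval₂AlgHom (toFive k) (X 1) fun _ => mul_comm _ _
  let ι : Polynomial (Polynomial (MvPolynomial (Fin 3) k)) →ₐ[k] MvPolynomial (Fin 5) k :=
    Polynomial.eval₂AlgHom ι₁ (X 0) fun _ => mul_comm _ _
  have hιC : ∀ r, ι (Polynomial.C r) = ι₁ r := fun r => Polynomial.eval₂_C _ _
  have hιX : ι Polynomial.X = X 0 := Polynomial.eval₂_X _ _
  have hι₁C : ∀ r, ι₁ (Polynomial.C r) = toFive k r := fun r => Polynomial.eval₂_C _ _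
  have hι₁X : ι₁ Polynomial.X = X 1 := Polynomial.eval₂_X _ _
  have hsurj : Function.Surjective ι := by
    rw [← AlgHom.range_eq_top, eq_top_iff, ← adjoin_range_X, Algebra.adjoin_le_iff]
    have h3 : ∀ i : Fin 3, ι (Polynomial.C (Polynomial.C (X i))) = X (Fin.natAdd 2 i) := fun i => by
      rw [hιC, hι₁C, toFive, rename_X]
    rintro _ ⟨i, rfl⟩
    fin_cases i
    · exact ⟨_, hιX⟩
    · exact ⟨Polynomial.C Polynomial.X, (hιC _).trans hι₁X⟩
    · exact ⟨_, h3 0⟩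
    · exact ⟨_, h3 1⟩
    · exact ⟨_, h3 2⟩
  have hF : ι (Polynomial.C (Polynomial.C a) * Polynomial.X +
      Polynomial.C (Polynomial.C b * Polynomial.X)) = toFive k a * X 0 + toFive k b * X 1 := by
    simp only [map_add, map_mul, hιC, hιX, hι₁C, hι₁X]
  have hcomp : ∀ r, rootSubst a b (ι₁ r) = r.comp (Polynomial.C a * Polynomial.X) := by
    intro r
    induction r using Polynomial.induction_on with
    | C r => rw [hι₁C, rootSubst_toFive, Polynomial.C_comp]
    | add p q hp hq => rw [map_add, map_add, hp, hq, Polynomial.add_comp]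
    | monomial n r _ =>
      simp only [map_mul, map_pow, hι₁C, hι₁X, rootSubst_toFive, rootSubst_X_one,
        Polynomial.mul_comp, Polynomial.pow_comp, Polynomial.C_comp, Polynomial.X_comp]
  have hrel : IsRelPrime (Polynomial.C a) (Polynomial.C b * Polynomial.X) := by
    rw [(Polynomial.prime_C_iff.2 ha).irreducible.isRelPrime_iff_not_dvd]
    intro h
    apply hab
    simpa using (Polynomial.C_dvd_iff_dvd_coeff _ _).1 h 1
  obtain ⟨P, rfl⟩ := hsurj P
  rw [← hF]
  refine map_dvd ι (Polynomial.C_mul_X_add_C_dvd_of_map_eq_zero (Polynomial.C_ne_zero.2 ha.ne_zero)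
    hrel ((rootSubst a b).toRingHom.comp ι.toRingHom) (fun r hr => ?_) ?_ hP)
  · have hr' : r.comp (Polynomial.C a * Polynomial.X) = 0 := by
      rw [← hcomp, ← hιC]; exact hr
    ext1 n
    have := congrArg (fun q => Polynomial.coeff q n) hr'
    simp only [Polynomial.comp_C_mul_X_coeff, Polynomial.coeff_zero] at this
    exact (mul_eq_zero.1 this).resolve_right (pow_ne_zero _ ha.ne_zero)
  · change rootSubst a b (ι _) = 0
    rw [hF]
    simp only [map_add, map_mul, rootSubst_toFive, rootSubst_X_zero, rootSubst_X_one]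
    ring

theorem rootSubst_mem_reesAlgebra (P : MvPolynomial (Fin 5) k) :
    rootSubst a b P ∈ reesAlgebra (Ideal.span {a, b}) := by
  induction P using MvPolynomial.induction_on with
  | C r =>
    rw [← algebraMap_eq, AlgHom.commutes, IsScalarTower.algebraMap_apply k
      (MvPolynomial (Fin 3) k) (Polynomial (MvPolynomial (Fin 3) k))]
    exact Subalgebra.algebraMap_mem _ _
  | add p q hp hq => rw [map_add]; exact add_mem hp hq
  | mul_X p i hp =>
    rw [map_mul]
    refine mul_mem hp ?_
    fin_cases i
    · change rootSubst a b (X 0) ∈ _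
      rw [rootSubst_X_zero, Polynomial.C_mul_X_eq_monomial]
      refine neg_mem ?_
      rw [reesAlgebra.monomial_mem, pow_one]
      exact Ideal.subset_span (by simp)
    · change rootSubst a b (X 1) ∈ _
      rw [rootSubst_X_one, Polynomial.C_mul_X_eq_monomial, reesAlgebra.monomial_mem, pow_one]
      exact Ideal.subset_span (by simp)
    all_goals
      rw [rootSubst, aeval_X]
      exact Subalgebra.algebraMap_mem _ (X _ : MvPolynomial (Fin 3) k)

theorem exists_rootSubst_eq_monomial {n : ℕ} {r : MvPolynomial (Fin 3) k}
    (hr : r ∈ Ideal.span {a, b} ^ n) : ∃ Q, rootSubst a b Q = Polynomial.monomial n r := by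
  have h := monomial_mem_adjoin_monomial hr
  generalize Polynomial.monomial n r = x at h
  induction h using Algebra.adjoin_induction with
  | mem x hx =>
    obtain ⟨y, hy, rfl⟩ := hx
    obtain ⟨u, v, rfl⟩ := Ideal.mem_span_pair.1 hy
    refine ⟨toFive k v * -X 0 + toFive k u * X 1, ?_⟩
    simp only [map_add, map_mul, map_neg, rootSubst_toFive, rootSubst_X_zero, rootSubst_X_one,
      ← Polynomial.C_mul_X_eq_monomial]
    ring
  | algebraMap r => exact ⟨toFive k r, rootSubst_toFive r⟩
  | add x y _ _ hx hy =>
    obtain ⟨P, rfl⟩ := hx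
    obtain ⟨Q, rfl⟩ := hy
    exact ⟨P + Q, map_add _ _ _⟩
  | mul x y _ _ hx hy =>
    obtain ⟨P, rfl⟩ := hx
    obtain ⟨Q, rfl⟩ := hy
    exact ⟨P * Q, map_mul _ _ _⟩

/-- Membership in an ideal containing `a s + b t` and lifts of `e, e u, …, e u ^ d` is detected
by divisibility of the image by `e`, when `e` has order `d` along `(a, b)`. -/
theorem mem_of_C_dvd_rootSubst (ha : Prime a) (hab : ¬ a ∣ b) {e : MvPolynomial (Fin 3) k} {d : ℕ}
    (he : ∀ n r, e * r ∈ Ideal.span {a, b} ^ (d + n) → r ∈ Ideal.span {a, b} ^ n)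
    {K : Ideal (MvPolynomial (Fin 5) k)} (hF : toFive k a * X 0 + toFive k b * X 1 ∈ K)
    (hK : ∀ i ≤ d, ∃ Q ∈ K, rootSubst a b Q = Polynomial.C e * Polynomial.X ^ i)
    {P : MvPolynomial (Fin 5) k} (hP : Polynomial.C e ∣ rootSubst a b P) : P ∈ K := by
  obtain ⟨r, hr⟩ := hP
  have key : ∀ n, ∃ Q ∈ K, rootSubst a b Q = Polynomial.monomial n (e * r.coeff n) := by
    intro n
    have hmem : e * r.coeff n ∈ Ideal.span {a, b} ^ n := by
      have := (mem_reesAlgebra_iff _ _).1 (rootSubst_mem_reesAlgebra (a := a) (b := b) P) n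
      rwa [hr, Polynomial.coeff_C_mul] at this
    rcases le_total n d with hn | hn
    · obtain ⟨Q, hQ, hQe⟩ := hK n hn
      refine ⟨toFive k (r.coeff n) * Q, K.mul_mem_left _ hQ, ?_⟩
      rw [map_mul, rootSubst_toFive, hQe, ← Polynomial.C_mul_X_pow_eq_monomial, map_mul]
      ring
    · obtain ⟨m, rfl⟩ := Nat.exists_eq_add_of_le hn
      obtain ⟨R, hR⟩ := exists_rootSubst_eq_monomial (he m _ hmem)
      obtain ⟨Q, hQ, hQe⟩ := hK d le_rfl
      refine ⟨R * Q, K.mul_mem_left _ hQ, ?_⟩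
      rw [map_mul, hR, hQe, ← Polynomial.C_mul_X_pow_eq_monomial,
        ← Polynomial.C_mul_X_pow_eq_monomial, map_mul]
      ring
  choose Q hQK hQ using key
  have hsum : rootSubst a b (P - ∑ n ∈ (Polynomial.C e * r).support, Q n) = 0 := by
    rw [map_sub, map_sum, hr, sub_eq_zero]
    conv_lhs => rw [(Polynomial.C e * r).as_sum_support]
    exact Finset.sum_congr rfl fun n _ => by rw [hQ, Polynomial.coeff_C_mul]
  obtain ⟨c, hc⟩ := dvd_of_rootSubst_eq_zero ha hab hsum
  rw [sub_eq_iff_eq_add] at hc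
  rw [hc]
  exact add_mem (K.mul_mem_right _ hF) (sum_mem fun n _ => hQK n)

theorem reesPresentation_X_zero (f : Fin 3 → MvPolynomial (Fin 2) k) :
    reesPresentation k f (X 0) = Polynomial.C (X 0) := by
  simp [reesPresentation]

theorem reesPresentation_X_one (f : Fin 3 → MvPolynomial (Fin 2) k) :
    reesPresentation k f (X 1) = Polynomial.C (X 1) := by
  simp [reesPresentation]

theorem reesPresentation_X_natAdd (f : Fin 3 → MvPolynomial (Fin 2) k) (i : Fin 3) :
    reesPresentation k f (X (Fin.natAdd 2 i)) = Polynomial.C (f i) * Polynomial.X := by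
  rw [reesPresentation, aeval_X]
  fin_cases i <;> rfl

theorem reesPresentation_toFive_linForm (f : Fin 3 → MvPolynomial (Fin 2) k) (v : Fin 3 → k) :
    reesPresentation k f (toFive k (linForm v)) =
      Polynomial.C (aeval f (linForm v)) * Polynomial.X := by
  have hC : ∀ r : k, reesPresentation k f (C r) = Polynomial.C (C r) := fun r =>
    (reesPresentation k f).commutes r
  simp only [linForm, toFive, map_sum, map_mul, rename_C, rename_X, reesPresentation_X_natAdd, hC,
    aeval_X, aeval_C, Finset.sum_mul, algebraMap_eq, mul_assoc]

/-- An element of the Rees ideal of `f` vanishes under `rootSubst` coefficientwise on the curve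
parametrized by `f`. -/
theorem map_rootSubst_eq_zero {f : Fin 3 → MvPolynomial (Fin 2) k} {d : ℕ}
    (hf : ∀ i, (f i).IsHomogeneous d) {m : MvPolynomial (Fin 2) k} (hm : m ≠ 0)
    (hfa : aeval f a = X 1 * m) (hfb : aeval f b = -(X 0 * m)) {P : MvPolynomial (Fin 5) k}
    (hP : reesPresentation k f P = 0) :
    (rootSubst a b P).map (aeval f : MvPolynomial (Fin 3) k →ₐ[k] _).toRingHom = 0 := by
  let L := FractionRing (Polynomial (MvPolynomial (Fin 2) k))
  let j : Polynomial (MvPolynomial (Fin 2) k) →+* L := algebraMap _ L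
  have hj : Function.Injective j := IsFractionRing.injective _ L
  let v : L := j (Polynomial.C m * Polynomial.X)
  have hv : v ≠ 0 := (map_ne_zero_iff j hj).2
    (mul_ne_zero (Polynomial.C_ne_zero.2 hm) Polynomial.X_ne_zero)
  let y : Fin 2 → L := fun i => j (Polynomial.C (X i))
  have hy : ∀ Q : MvPolynomial (Fin 2) k, aeval y Q = j (Polynomial.C Q) := by
    have : (aeval y : MvPolynomial (Fin 2) k →ₐ[k] L).toRingHom = j.comp Polynomial.C := by
      refine MvPolynomial.ringHom_ext (fun r => ?_) fun i => ?_
      · change aeval y (C r) = _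
        rw [aeval_C]
        rfl
      · exact aeval_X _ i
    exact fun Q => DFunLike.congr_fun this Q
  let ν : Polynomial (MvPolynomial (Fin 2) k) →+* L :=
    Polynomial.eval₂RingHom (aeval fun i => y i * v).toRingHom (v ^ d)⁻¹
  have hνC : ∀ Q, ν (Polynomial.C Q) = aeval (fun i => y i * v) Q := fun Q => by
    simp only [ν, Polynomial.coe_eval₂RingHom, Polynomial.eval₂_C]; rfl
  have hνX : ν Polynomial.X = (v ^ d)⁻¹ := by
    simp only [ν, Polynomial.coe_eval₂RingHom, Polynomial.eval₂_X]
  have hfa' : (aeval f : MvPolynomial (Fin 3) k →ₐ[k] _).toRingHom a = X 1 * m := hfa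
  have hfb' : (aeval f : MvPolynomial (Fin 3) k →ₐ[k] _).toRingHom b = -(X 0 * m) := hfb
  have h3 : ∀ i : Fin 3, ν (reesPresentation k f (X (Fin.natAdd 2 i))) =
      j ((rootSubst a b (X (Fin.natAdd 2 i))).map
        (aeval f : MvPolynomial (Fin 3) k →ₐ[k] _).toRingHom) := by
    intro i
    have h4 : rootSubst a b (X (Fin.natAdd 2 i)) = Polynomial.C (X i) := by
      rw [← rootSubst_toFive (a := a) (b := b), toFive, rename_X]
    have h5 : (aeval f : MvPolynomial (Fin 3) k →ₐ[k] _).toRingHom (X i) = f i := aeval_X f i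
    rw [h4, reesPresentation_X_natAdd, map_mul, hνC, hνX, (hf i).aeval_mul_right, hy,
      Polynomial.map_C, h5, mul_right_comm, mul_inv_cancel₀ (pow_ne_zero _ hv), one_mul]
  have key : ν.comp (reesPresentation k f).toRingHom =
      j.comp ((Polynomial.mapRingHom (aeval f).toRingHom).comp (rootSubst a b).toRingHom) := by
    refine MvPolynomial.ringHom_ext (fun r => ?_) fun i => ?_
    · change ν (reesPresentation k f (C r)) = j ((rootSubst a b (C r)).map _)
      rw [← algebraMap_eq, AlgHom.commutes, AlgHom.commutes]
      change ν (Polynomial.C (C r)) = j ((Polynomial.C (C r)).map _)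
      rw [hνC, Polynomial.map_C, aeval_C]
      change _ = j (Polynomial.C (aeval f (C r)))
      rw [aeval_C]
      rfl
    · fin_cases i
      · change ν (reesPresentation k f (X 0)) = j ((rootSubst a b (X 0)).map _)
        rw [rootSubst_X_zero, reesPresentation_X_zero, hνC, aeval_X, Polynomial.map_neg,
          Polynomial.map_mul, Polynomial.map_X, Polynomial.map_C, hfb', ← map_mul]
        congr 1
        simp only [map_neg, map_mul]
        ring
      · change ν (reesPresentation k f (X 1)) = j ((rootSubst a b (X 1)).map _)
        rw [rootSubst_X_one, reesPresentation_X_one, hνC, aeval_X,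
          Polynomial.map_mul, Polynomial.map_X, Polynomial.map_C, hfa', ← map_mul]
        congr 1
        simp only [map_mul]
        ring
      · exact h3 0
      · exact h3 1
      · exact h3 2
  apply hj
  rw [map_zero]
  refine (DFunLike.congr_fun key P).symm.trans ?_
  change ν (reesPresentation k f P) = 0
  rw [hP, map_zero]

end RootSubst

section HilbertBurch

variable {k : Type*} [Field k] {M : Matrix (Fin 3) (Fin 3) k} {w : Fin 5 → Fin 3 → k}
  {φ : Matrix (Fin 3) (Fin 2) (MvPolynomial (Fin 2) k)} {f : Fin 3 → MvPolynomial (Fin 2) k}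

/-- If the minors of a `3 × 2` matrix with linear first column generate an ideal of height two,
then the two coefficient vectors of that column extend to a basis. -/
theorem exists_det_ne_zero_of_heightOf_eq_two {u v : Fin 3 → k}
    (hφ : ∀ i, φ i 0 = C (u i) * X 0 + C (v i) * X 1)
    (hf : ∀ j, f j = (-1) ^ (j : ℕ) * (φ.submatrix j.succAbove id).det)
    (hht : (Ideal.span (Set.range f)).heightOf = 2) :
    ∃ c : Fin 3 → k, (Matrix.of ![u, v, c]).det ≠ 0 := by
  have hcross : crossProduct u v ≠ 0 := by
    intro h0
    have hdep : ¬ LinearIndependent k ![u, v] := fun h =>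
      (crossProduct_ne_zero_iff_linearIndependent.2 h) h0
    have hprop : ∃ (z : Fin 3 → k) (p q : k), u = p • z ∧ v = q • z := by
      rw [LinearIndependent.pair_iff] at hdep
      push Not at hdep
      obtain ⟨p, q, hpq, hne⟩ := hdep
      by_cases hp : p = 0
      · refine ⟨u, 1, 0, (one_smul _ _).symm, ?_⟩
        rw [hp, zero_smul, zero_add] at hpq
        rw [zero_smul, (smul_eq_zero.1 hpq).resolve_left (hne hp)]
      · refine ⟨v, -(p⁻¹ * q), 1, ?_, (one_smul _ _).symm⟩
        have h1 : p • u = -(q • v) := eq_neg_of_add_eq_zero_left hpq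
        rw [neg_smul, mul_smul, ← smul_neg, ← h1, smul_smul, inv_mul_cancel₀ hp, one_smul]
    obtain ⟨z, p, q, rfl, rfl⟩ := hprop
    have hφ' : ∀ i, φ i 0 = (C p * X 0 + C q * X 1) * C (z i) := fun i => by
      rw [hφ]
      simp only [Pi.smul_apply, smul_eq_mul, map_mul]
      ring
    have hunit : IsUnit (C p * X 0 + C q * X 1 : MvPolynomial (Fin 2) k) := by
      refine Ideal.isUnit_of_dvd_of_heightOf_eq_two hht fun x hx => ?_
      rw [← Ideal.mem_span_singleton]
      revert x
      change Ideal.span (Set.range f) ≤ _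
      rw [Ideal.span_le]
      rintro _ ⟨i, rfl⟩
      rw [SetLike.mem_coe, Ideal.mem_span_singleton, hf, Matrix.det_fin_two]
      simp only [Matrix.submatrix_apply, id, hφ']
      refine Dvd.dvd.mul_left (dvd_sub ?_ ?_) _
      · exact (Dvd.intro _ rfl).mul_right _
      · exact (Dvd.intro _ rfl).mul_left _
    have h1 := hunit.map (constantCoeff (R := k) (σ := Fin 2))
    simp at h1
  obtain ⟨i, hi⟩ := Function.ne_iff.1 hcross
  refine ⟨Pi.single i 1, ?_⟩
  rw [Matrix.det_fin_three]
  rw [cross_apply] at hi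
  fin_cases i <;> simp at hi ⊢ <;> intro h <;> apply hi <;> linear_combination h

theorem linForm_aeval_minors {α β γ : Fin 5 → k}
    (hφ0 : ∀ i, φ i 0 = C (M 0 i) * X 0 + C (M 1 i) * X 1)
    (hφ1 : ∀ i, φ i 1 = C (M 0 i) * quartic α + C (M 1 i) * quartic β + C (M 2 i) * quartic γ)
    (hf : ∀ j, f j = (-1) ^ (j : ℕ) * (φ.submatrix j.succAbove id).det) :
    aeval f (linForm (M 0)) = X 1 * (C M.det * quartic γ) ∧
    aeval f (linForm (M 1)) = -(X 0 * (C M.det * quartic γ)) ∧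
    aeval f (linForm (M 2)) = C M.det * (X 0 * quartic β - X 1 * quartic α) := by
  have h0 : f 0 = φ 1 0 * φ 2 1 - φ 1 1 * φ 2 0 := by
    rw [hf, Matrix.det_fin_two]; simp
  have h1 : f 1 = -(φ 0 0 * φ 2 1 - φ 0 1 * φ 2 0) := by
    rw [hf, Matrix.det_fin_two]; simp [Fin.succAbove]
  have h2 : f 2 = φ 0 0 * φ 1 1 - φ 0 1 * φ 1 0 := by
    rw [hf, Matrix.det_fin_two]; simp [Fin.succAbove]
  simp only [linForm, map_mul, aeval_C, aeval_X, algebraMap_eq, Fin.sum_univ_three,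
    h0, h1, h2, hφ0, hφ1, Matrix.det_fin_three, map_add, map_sub]
  refine ⟨?_, ?_, ?_⟩ <;> ring

theorem minors_isHomogeneous {m n : ℕ} (h0 : ∀ i, (φ i 0).IsHomogeneous m)
    (h1 : ∀ i, (φ i 1).IsHomogeneous n)
    (hf : ∀ j, f j = (-1) ^ (j : ℕ) * (φ.submatrix j.succAbove id).det) (j : Fin 3) :
    (f j).IsHomogeneous (m + n) := by
  rw [hf, Matrix.det_fin_two]
  simp only [Matrix.submatrix_apply, id]
  have h := ((h0 (j.succAbove 0)).mul (h1 (j.succAbove 1))).sub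
    (add_comm n m ▸ (h1 (j.succAbove 0)).mul (h0 (j.succAbove 1)))
  simpa using ((isHomogeneous_C (Fin 2) ((-1 : k) ^ (j : ℕ))).mul h)

end HilbertBurch

section Sylvester

variable {k : Type*} [Field k]

theorem setSZero_X_zero : setSZero k (X 0) = 0 := by simp [setSZero]

theorem setSZero_X_one : setSZero k (X 1) = X 1 := by simp [setSZero]

theorem setSZero_toFive (p : MvPolynomial (Fin 3) k) : setSZero k (toFive k p) = toFive k p := by
  have : (setSZero k).comp (toFive k) = toFive k := by
    refine MvPolynomial.algHom_ext fun i => ?_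
    rw [AlgHom.comp_apply, toFive, rename_X, setSZero, aeval_X, if_neg]
    intro h
    simpa using congrArg Fin.val h
  exact DFunLike.congr_fun this p

/-- The iterated Sylvester forms of `a s + b t` with a binary cubic `∑ zᵢ s³⁻ⁱ tⁱ`. -/
theorem iterated_sylvester_form {a b : MvPolynomial (Fin 3) k} {z : Fin 4 → MvPolynomial (Fin 3) k}
    {h₁ h₂ h₃ h₄ A₁ B₁ A₂ B₂ A₃ B₃ : MvPolynomial (Fin 5) k}
    (hh₁ : h₁ = toFive k (z 0) * X 0 ^ 3 + toFive k (z 1) * (X 0 ^ 2 * X 1) +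
      toFive k (z 2) * (X 0 * X 1 ^ 2) + toFive k (z 3) * X 1 ^ 3)
    (hs₁ : h₁ = A₁ * X 0 + B₁ * X 1) (hB₁ : B₁ * X 1 = setSZero k h₁)
    (hh₂ : h₂ = toFive k a * B₁ - toFive k b * A₁)
    (hs₂ : h₂ = A₂ * X 0 + B₂ * X 1) (hB₂ : B₂ * X 1 = setSZero k h₂)
    (hh₃ : h₃ = toFive k a * B₂ - toFive k b * A₂)
    (hs₃ : h₃ = A₃ * X 0 + B₃ * X 1) (hB₃ : B₃ * X 1 = setSZero k h₃)
    (hh₄ : h₄ = toFive k a * B₃ - toFive k b * A₃) :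
    h₄ = toFive k (a ^ 3 * z 3 - a ^ 2 * b * z 2 + a * b ^ 2 * z 1 - b ^ 3 * z 0) := by
  have hX0 : (X 0 : MvPolynomial (Fin 5) k) ≠ 0 := X_ne_zero 0
  have hX1 : (X 1 : MvPolynomial (Fin 5) k) ≠ 0 := X_ne_zero 1
  have eB₁ : B₁ = toFive k (z 3) * X 1 ^ 2 := by
    apply mul_right_cancel₀ hX1
    rw [hB₁, hh₁]
    simp only [map_add, map_mul, map_pow, setSZero_X_zero, setSZero_X_one, setSZero_toFive]
    ring
  have eA₁ : A₁ = toFive k (z 0) * X 0 ^ 2 + toFive k (z 1) * (X 0 * X 1) +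
      toFive k (z 2) * X 1 ^ 2 := by
    apply mul_right_cancel₀ hX0
    linear_combination hh₁ - hs₁ - X 1 * eB₁
  rw [eB₁, eA₁] at hh₂
  have eB₂ : B₂ = toFive k (a * z 3 - b * z 2) * X 1 := by
    apply mul_right_cancel₀ hX1
    rw [hB₂, hh₂]
    simp only [map_add, map_sub, map_mul, map_pow, setSZero_X_zero, setSZero_X_one,
      setSZero_toFive]
    ring
  have eA₂ : A₂ = -toFive k b * (toFive k (z 0) * X 0 + toFive k (z 1) * X 1) := by
    apply mul_right_cancel₀ hX0
    simp only [map_sub, map_mul] at eB₂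
    linear_combination hh₂ - hs₂ - X 1 * eB₂
  rw [eB₂, eA₂] at hh₃
  have eB₃ : B₃ = toFive k (a * (a * z 3 - b * z 2) + b ^ 2 * z 1) := by
    apply mul_right_cancel₀ hX1
    rw [hB₃, hh₃]
    simp only [map_add, map_sub, map_mul, map_pow, map_neg, setSZero_X_zero, setSZero_X_one,
      setSZero_toFive]
    ring
  have eA₃ : A₃ = toFive k (b ^ 2 * z 0) := by
    apply mul_right_cancel₀ hX0
    simp only [map_add, map_sub, map_mul, map_pow] at eB₃ hh₃ ⊢
    linear_combination hh₃ - hs₃ - X 1 * eB₃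
  rw [hh₄, eB₃, eA₃]
  simp only [map_add, map_sub, map_mul, map_pow]
  ring

end Sylvester

/-- degree 5, column degrees 1 and 4. With `f = as + bt`,
`g = cs + dt`, `c = x₁s³ + x₂s²t + x₃st² + x₄t³`, `d = y₁s³ + y₂s²t + y₃st² + y₄t³`
(`a, b, xᵢ, yᵢ` `k`-linear forms in `T₁,T₂,T₃`), `h₁ = ad − bc` and, inductively,
`h_{i+1} = det(f, h_i)_{(s,t)}` (writing `h_i = As + Bt` with the evident coefficients and
setting `h_{i+1} = aB − bA`), the defining ideal of the Rees algebra `R[It]` in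
`S = R[T₁,T₂,T₃]` equals `(f, g, h₁, h₂, h₃, h₄)`, and `h₄` is the elimination
equation. -/
theorem rees_defining_ideal_deg5_nonbalanced
    (k : Type*) [Field k] [Infinite k]
    (a b : MvPolynomial (Fin 3) k) (xs ys : Fin 4 → MvPolynomial (Fin 3) k)
    (hlin : ∀ p ∈ ({a, b} : Set (MvPolynomial (Fin 3) k)) ∪ Set.range xs ∪ Set.range ys,
      p ∈ Submodule.span k (Set.range (X : Fin 3 → MvPolynomial (Fin 3) k)))
    (φ : Matrix (Fin 3) (Fin 2) (MvPolynomial (Fin 2) k))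
    (hφ1 : ∀ i, φ i 0 =
      C (coeff (Finsupp.single i 1) a) * X 0 + C (coeff (Finsupp.single i 1) b) * X 1)
    (hφ2 : ∀ i, φ i 1 =
      C (coeff (Finsupp.single i 1) (xs 0)) * X 0 ^ 4 +
      C (coeff (Finsupp.single i 1) (xs 1) + coeff (Finsupp.single i 1) (ys 0)) *
        (X 0 ^ 3 * X 1) +
      C (coeff (Finsupp.single i 1) (xs 2) + coeff (Finsupp.single i 1) (ys 1)) *
        (X 0 ^ 2 * X 1 ^ 2) +
      C (coeff (Finsupp.single i 1) (xs 3) + coeff (Finsupp.single i 1) (ys 2)) *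
        (X 0 * X 1 ^ 3) +
      C (coeff (Finsupp.single i 1) (ys 3)) * X 1 ^ 4)
    (f : Fin 3 → MvPolynomial (Fin 2) k)
    (hf : ∀ j, f j = (-1) ^ (j : ℕ) * (φ.submatrix j.succAbove id).det)
    (I : Ideal (MvPolynomial (Fin 2) k)) (hI : I = Ideal.span (Set.range f))
    (hht : I.heightOf = 2)
    (hmin : ¬ ∃ g₁ g₂ : MvPolynomial (Fin 2) k, I = Ideal.span {g₁, g₂})
    -- the symmetric algebra equations and the iterated Sylvester forms
    (F G cS dS h₁ h₂ h₃ h₄ A₁ B₁ A₂ B₂ A₃ B₃ : MvPolynomial (Fin 5) k)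
    (hcS : cS = toFive k (xs 0) * X 0 ^ 3 + toFive k (xs 1) * (X 0 ^ 2 * X 1) +
      toFive k (xs 2) * (X 0 * X 1 ^ 2) + toFive k (xs 3) * X 1 ^ 3)
    (hdS : dS = toFive k (ys 0) * X 0 ^ 3 + toFive k (ys 1) * (X 0 ^ 2 * X 1) +
      toFive k (ys 2) * (X 0 * X 1 ^ 2) + toFive k (ys 3) * X 1 ^ 3)
    (hF : F = toFive k a * X 0 + toFive k b * X 1)
    (hG : G = cS * X 0 + dS * X 1)
    (hh₁ : h₁ = toFive k a * dS - toFive k b * cS)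
    (hs₁ : h₁ = A₁ * X 0 + B₁ * X 1) (hB₁ : B₁ * X 1 = setSZero k h₁)
    (hh₂ : h₂ = toFive k a * B₁ - toFive k b * A₁)
    (hs₂ : h₂ = A₂ * X 0 + B₂ * X 1) (hB₂ : B₂ * X 1 = setSZero k h₂)
    (hh₃ : h₃ = toFive k a * B₂ - toFive k b * A₂)
    (hs₃ : h₃ = A₃ * X 0 + B₃ * X 1) (hB₃ : B₃ * X 1 = setSZero k h₃)
    (hh₄ : h₄ = toFive k a * B₃ - toFive k b * A₃) :
    RingHom.ker (reesPresentation k f) = Ideal.span {F, G, h₁, h₂, h₃, h₄} ∧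
      ∃ e : MvPolynomial (Fin 3) k, toFive k e = h₄ ∧
        RingHom.ker
            (MvPolynomial.aeval f :
              MvPolynomial (Fin 3) k →ₐ[k] MvPolynomial (Fin 2) k) =
          Ideal.span {e} := by
  let v : MvPolynomial (Fin 3) k → Fin 3 → k := fun p i => coeff (Finsupp.single i 1) p
  have hv : ∀ p ∈ ({a, b} : Set (MvPolynomial (Fin 3) k)) ∪ Set.range xs ∪ Set.range ys,
      linForm (v p) = p := fun p hp => linForm_coeff_of_mem_span (hlin p hp)
  have hva : linForm (v a) = a := hv a (by simp)
  have hvb : linForm (v b) = b := hv b (by simp)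
  have hvx : ∀ i, linForm (v (xs i)) = xs i := fun i => hv _ (by simp)
  have hvy : ∀ i, linForm (v (ys i)) = ys i := fun i => hv _ (by simp)
  subst hI
  obtain ⟨c, hM⟩ := exists_det_ne_zero_of_heightOf_eq_two (u := v a) (v := v b) hφ1 hf hht
  set M : Matrix (Fin 3) (Fin 3) k := Matrix.of ![v a, v b, c] with hMdef
  have hM0 : linForm (M 0) = a := hva
  have hM1 : linForm (M 1) = b := hvb
  let w : Fin 5 → Fin 3 → k := ![v (xs 0), v (xs 1) + v (ys 0), v (xs 2) + v (ys 1),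
    v (xs 3) + v (ys 2), v (ys 3)]
  let α : Fin 5 → k := fun j => Matrix.vecMul (w j) M⁻¹ 0
  let β : Fin 5 → k := fun j => Matrix.vecMul (w j) M⁻¹ 1
  let γ : Fin 5 → k := fun j => Matrix.vecMul (w j) M⁻¹ 2
  have hw : ∀ j, w j = α j • M 0 + β j • M 1 + γ j • M 2 := fun j => eq_sum_vecMul_inv hM (w j)
  have hφ2' : ∀ i, φ i 1 =
      C (M 0 i) * quartic α + C (M 1 i) * quartic β + C (M 2 i) * quartic γ := by
    intro i
    have h1 : φ i 1 = quartic fun j => w j i := by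
      rw [hφ2, quartic, Fin.sum_univ_five]
      simp [w, v]
    have h2 : (fun j => w j i) = fun j => α j * M 0 i + β j * M 1 i + γ j * M 2 i := by
      funext j
      rw [hw j]
      rfl
    rw [h1, h2]
    simp only [quartic, Fin.sum_univ_five, map_add, map_mul]
    ring
  obtain ⟨hfa, hfb, hfc⟩ := linForm_aeval_minors (M := M) hφ1 hφ2' hf
  have hrel := isRelPrime_of_heightOf_eq_two hM hfa hfb hfc hht
  have hγ := quartic_ne_zero_of_isRelPrime hrel
  have hker := ker_aeval_eq_span_implicitForm hM hM hw hfa hfb hfc hrel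
  have hw0 : linForm (w 0) = xs 0 := hvx 0
  have hw1 : linForm (w 1) = xs 1 + ys 0 := (linForm_add _ _).trans (by rw [hvx, hvy])
  have hw2 : linForm (w 2) = xs 2 + ys 1 := (linForm_add _ _).trans (by rw [hvx, hvy])
  have hw3 : linForm (w 3) = xs 3 + ys 2 := (linForm_add _ _).trans (by rw [hvx, hvy])
  have hw4 : linForm (w 4) = ys 3 := hvy 3
  have he : toFive k (implicitForm M w) = h₄ := by
    rw [iterated_sylvester_form (a := a) (b := b) (z := fun i => a * ys i - b * xs i)
      (by rw [hh₁, hcS, hdS]; simp only [map_sub, map_mul]; ring)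
      hs₁ hB₁ hh₂ hs₂ hB₂ hh₃ hs₃ hB₃ hh₄]
    refine congrArg (toFive k) ?_
    simp only [implicitForm, Fin.sum_univ_five, hM0, hM1, hw0, hw1, hw2, hw3, hw4]
    simp
    ring
  refine ⟨le_antisymm (fun P hP => ?_) ?_, implicitForm M w, he, hker⟩
  · have hm : C M.det * quartic γ ≠ 0 := mul_ne_zero (by simpa using hM) hγ
    have hhom : ∀ j, (f j).IsHomogeneous 5 := by
      refine minors_isHomogeneous (m := 1) (n := 4) (fun i => ?_) (fun i => ?_) hf
      · rw [hφ1]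
        exact (isHomogeneous_C_mul_X _ _).add (isHomogeneous_C_mul_X _ _)
      · rw [hφ2']
        have h : ∀ (r : k) (κ : Fin 5 → k), (C r * quartic κ).IsHomogeneous 4 := fun r κ => by
          simpa using (isHomogeneous_C (Fin 2) r).mul (quartic_isHomogeneous κ)
        exact ((h _ _).add (h _ _)).add (h _ _)
    have hmap := map_rootSubst_eq_zero hhom hm (hM0 ▸ hfa) (hM1 ▸ hfb) hP
    have hdvd : Polynomial.C (implicitForm M w) ∣ rootSubst a b P := by
      rw [Polynomial.C_dvd_iff_dvd_coeff]
      intro n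
      rw [← Ideal.mem_span_singleton, ← hker, RingHom.mem_ker]
      have := congrArg (fun q => Polynomial.coeff q n) hmap
      rwa [Polynomial.coeff_map, Polynomial.coeff_zero] at this
    obtain ⟨ρ, hρ0, hρ1, -⟩ := exists_algEquiv_linForm hM
    rw [hM1] at hρ0
    rw [hM0] at hρ1
    have ha : Prime a := by
      rw [← hρ1, MulEquiv.prime_iff, Polynomial.prime_C_iff]
      exact X_prime
    have hab : ¬ a ∣ b := by
      rw [← dvd_neg, ← hρ0, ← hρ1, map_dvd_iff ρ, Polynomial.C_dvd_iff_dvd_coeff]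
      intro h
      have := h 0
      rw [Polynomial.coeff_C_zero, X_dvd_X] at this
      simp at this
    have hΦ₄ : rootSubst a b h₄ = Polynomial.C (implicitForm M w) := by
      rw [← he, rootSubst_toFive]
    have hstep : ∀ A B h : MvPolynomial (Fin 5) k, h = toFive k a * B - toFive k b * A →
        rootSubst a b (A * X 0 + B * X 1) = rootSubst a b h * Polynomial.X := by
      rintro A B _ rfl
      simp only [map_add, map_sub, map_mul, rootSubst_toFive, rootSubst_X_zero, rootSubst_X_one]
      ring
    have hΦ₃ := hs₃ ▸ hstep A₃ B₃ h₄ hh₄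
    have hΦ₂ := hs₂ ▸ hstep A₂ B₂ h₃ hh₃
    have hΦ₁ := hs₁ ▸ hstep A₁ B₁ h₂ hh₂
    have hΦG := hG ▸ hstep cS dS h₁ hh₁
    refine mem_of_C_dvd_rootSubst ha hab (d := 4) (fun n r hr => ?_)
      (hF ▸ Ideal.subset_span (by simp)) (fun i hi => ?_) hdvd
    · rw [← hM0, ← hM1] at hr ⊢
      exact mem_pow_of_implicitForm_mul_mem_pow hM hw hγ hr
    · interval_cases i
      · exact ⟨h₄, Ideal.subset_span (by simp), by rw [hΦ₄]; ring⟩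
      · exact ⟨h₃, Ideal.subset_span (by simp), by rw [hΦ₃, hΦ₄]; ring⟩
      · exact ⟨h₂, Ideal.subset_span (by simp), by rw [hΦ₂, hΦ₃, hΦ₄]; ring⟩
      · exact ⟨h₁, Ideal.subset_span (by simp), by rw [hΦ₁, hΦ₂, hΦ₃, hΦ₄]; ring⟩
      · exact ⟨G, Ideal.subset_span (by simp), by rw [hΦG, hΦ₁, hΦ₂, hΦ₃, hΦ₄]; ring⟩
  · have hFJ : reesPresentation k f F = 0 := by
      rw [hF, ← hM0, ← hM1]
      simp only [map_add, map_mul, reesPresentation_toFive_linForm, reesPresentation_X_zero,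
        reesPresentation_X_one, hfa, hfb, map_neg]
      ring
    have hGJ : reesPresentation k f G = 0 := by
      have h1 : G = ∑ j : Fin 5,
          toFive k (linForm (w j)) * (X 0 ^ (4 - (j : ℕ)) * X 1 ^ (j : ℕ)) := by
        rw [hG, hcS, hdS]
        simp only [Fin.sum_univ_five, hw0, hw1, hw2, hw3, hw4]
        simp
        ring
      have h2 : ∀ j, aeval f (linForm (w j)) = C (α j) * aeval f (linForm (M 0)) +
          C (β j) * aeval f (linForm (M 1)) + C (γ j) * aeval f (linForm (M 2)) := fun j => by
        rw [hw j]
        simp only [linForm_add, linForm_smul, map_add, map_mul, aeval_C, algebraMap_eq]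
      have h3 : reesPresentation k f G = Polynomial.C (quartic α * aeval f (linForm (M 0)) +
          quartic β * aeval f (linForm (M 1)) + quartic γ * aeval f (linForm (M 2))) *
          Polynomial.X := by
        rw [h1]
        simp only [map_mul, map_pow, reesPresentation_toFive_linForm,
          reesPresentation_X_zero, reesPresentation_X_one, h2, quartic, Fin.sum_univ_five, map_add]
        ring
      rw [h3, hfa, hfb, hfc, mul_eq_zero, Polynomial.C_eq_zero]
      left
      ring
    have hcancel : ∀ A B h : MvPolynomial (Fin 5) k, h = toFive k a * B - toFive k b * A →
        reesPresentation k f (A * X 0 + B * X 1) = 0 → reesPresentation k f h = 0 := by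
      intro A B h hh hAB
      have h1 : h * X 0 = B * F - toFive k b * (A * X 0 + B * X 1) := by rw [hh, hF]; ring
      have h2 := congrArg (reesPresentation k f) h1
      rw [map_sub, map_mul, map_mul, map_mul, hFJ, hAB, mul_zero, mul_zero, sub_zero,
        reesPresentation_X_zero] at h2
      exact (mul_eq_zero.1 h2).resolve_right (Polynomial.C_ne_zero.2 (X_ne_zero 0))
    have hJ₁ := hcancel cS dS h₁ hh₁ (hG ▸ hGJ)
    have hJ₂ := hcancel A₁ B₁ h₂ hh₂ (hs₁ ▸ hJ₁)
    have hJ₃ := hcancel A₂ B₂ h₃ hh₃ (hs₂ ▸ hJ₂)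
    have hJ₄ := hcancel A₃ B₃ h₄ hh₄ (hs₃ ▸ hJ₃)
    rw [Ideal.span_le]
    rintro P (rfl | rfl | rfl | rfl | rfl | rfl) <;> assumption
end

section
/- Let k be an infinite field, R = k[s,t], and let I ⊂ R be a height-2 ideal minimally generated by three forms of degree 5 whose Hilbert–Burch matrix has columns of degrees 2 and 3, with first column (s^2, st, t^2)^t. In S = R[x,y,z] write f = s^2 x + st y + t^2 z and g = s^3 A + s^2 t B + s t^2 C + t^3 D, where A, B, C, D are the k-linear forms in x, y, z determined by the second column. Set h_1 = −yA s^2 + (xC − yB − zA) st + (xD − zB) t^2, h_2 = (xC − zA) s^2 + (xD + yC − zB) st + yD t^2, c_1 = x^2(Cs + Dt) − xyBs − xz(As + Bt) + yzAt + y^2As, c_2 = x^2Ds + xyDt − xz(Bs + Ct) + yzAs + z^2At, c_4 = xyDs + y^2Dt − xz(Cs + Dt) − yzCt + z^2(As + Bt), and F = −x^3D^2 + x^2yCD − xy^2BD + x^2z(2BD − C^2) + xz^2(2AC − B^2) + xyz(BC − 3AD) − y^2zAC + yz^2AB + y^3AD − z^3A^2. Then, for a generic choice of the linear forms A, B, C,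 D (i.e., for all parameter choices in a suitable nonempty Zariski-open set), the defining ideal of the Rees algebra R[It] in S equals (f, g, h_1, h_2, c_1, c_2, c_4, F). -/
open MvPolynomial

/-! ### Setting variables to zero and Koszul relations among variables -/

lemma koszul_two {σ k : Type*} [Field k] {i j : σ} (hij : i ≠ j) {a b : MvPolynomial σ k}
    (h : a * X i + b * X j = 0) : ∃ q, a = q * X j ∧ b = -q * X i := by
  have hd : X i ∣ b * X j := ⟨-a, by linear_combination h⟩
  obtain ⟨q, rfl⟩ : X i ∣ b := (X_prime.dvd_or_dvd hd).resolve_right fun h' => by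
    rw [X_dvd_X] at h'; exact hij h'
  refine ⟨-q, mul_right_cancel₀ (X_ne_zero i) ?_, by ring⟩
  linear_combination h

/-- The substitution `X i ↦ 0`, fixing the other variables. -/
noncomputable def substZero {σ k : Type*} [DecidableEq σ] [CommRing k] (i : σ) :
    MvPolynomial σ k →ₐ[k] MvPolynomial σ k :=
  aeval (Function.update X i 0)

section SubstZero

variable {σ k : Type*} [DecidableEq σ] [Field k]

@[simp]
lemma substZero_X_self (i : σ) : substZero i (X i : MvPolynomial σ k) = 0 := by
  simp [substZero]

lemma substZero_X_of_ne {i j : σ} (h : j ≠ i) :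
    substZero i (X j : MvPolynomial σ k) = X j := by
  simp [substZero, h]

@[simp]
lemma substZero_C (i : σ) (a : k) : substZero i (C a : MvPolynomial σ k) = C a :=
  (substZero i).commutes a

lemma X_dvd_sub_substZero (i : σ) (u : MvPolynomial σ k) : X i ∣ u - substZero i u := by
  induction u using MvPolynomial.induction_on with
  | C a => simp
  | add p q hp hq => rw [map_add, add_sub_add_comm]; exact dvd_add hp hq
  | mul_X p j hp =>
    rcases eq_or_ne j i with rfl | h
    · simp
    · rw [map_mul, substZero_X_of_ne h, ← sub_mul]; exact hp.mul_right _

lemma exists_eq_substZero_add (i : σ) (u : MvPolynomial σ k) :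
    ∃ v, u = substZero i u + X i * v := by
  obtain ⟨v, hv⟩ := X_dvd_sub_substZero i u
  exact ⟨v, by rw [← hv]; ring⟩

lemma X_dvd_iff_substZero_eq_zero (i : σ) (u : MvPolynomial σ k) :
    X i ∣ u ↔ substZero i u = 0 := by
  refine ⟨?_, fun h => ?_⟩
  · rintro ⟨v, rfl⟩; simp
  · simpa [h] using X_dvd_sub_substZero i u

lemma totalDegree_substZero_le (i : σ) (u : MvPolynomial σ k) :
    (substZero i u).totalDegree ≤ u.totalDegree := by
  rw [substZero, aeval_def, eval₂_eq]
  refine (totalDegree_finsetSum _ _).trans (Finset.sup_le fun d hd => ?_)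
  refine le_trans ?_ (le_totalDegree hd)
  refine (totalDegree_mul _ _).trans ?_
  rw [algebraMap_eq, totalDegree_C, zero_add]
  refine (totalDegree_finsetProd _ _).trans (Finset.sum_le_sum fun j _ => ?_)
  refine (totalDegree_pow _ _).trans ?_
  refine (Nat.mul_le_mul_left _ (?_ : _ ≤ 1)).trans_eq (mul_one _)
  rcases eq_or_ne j i with rfl | h <;> simp [*]

lemma koszul_three {i j l : σ} (hij : i ≠ j) (hil : i ≠ l) (hjl : j ≠ l)
    {a b c : MvPolynomial σ k} (h : a * X i + b * X j + c * X l = 0) :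
    ∃ p q r, a = p * X j + q * X l ∧ b = -p * X i + r * X l ∧ c = -q * X i - r * X j := by
  obtain ⟨q, hq⟩ := exists_eq_substZero_add l a
  obtain ⟨r, hr⟩ := exists_eq_substZero_add l b
  have h0 := congrArg (substZero l) h
  simp only [map_add, map_mul, substZero_X_self, substZero_X_of_ne hil, substZero_X_of_ne hjl,
    map_zero, mul_zero, add_zero] at h0
  obtain ⟨p, hp, hp'⟩ := koszul_two hij h0
  rw [hp] at hq
  rw [hp'] at hr
  refine ⟨p, q, r, by rw [hq]; ring, by rw [hr]; ring, mul_right_cancel₀ (X_ne_zero l) ?_⟩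
  rw [hq, hr] at h
  linear_combination h

lemma koszul_four {i j l m : σ} (hij : i ≠ j) (hil : i ≠ l) (hjl : j ≠ l)
    (him : i ≠ m) (hjm : j ≠ m) (hlm : l ≠ m)
    {a b c d : MvPolynomial σ k} (h : a * X i + b * X j + c * X l + d * X m = 0) :
    ∃ p q r u v w, a = p * X j + q * X l + u * X m ∧ b = -p * X i + r * X l + v * X m ∧
      c = -q * X i - r * X j + w * X m ∧ d = -u * X i - v * X j - w * X l := by
  obtain ⟨u, hu⟩ := exists_eq_substZero_add m a
  obtain ⟨v, hv⟩ := exists_eq_substZero_add m b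
  obtain ⟨w, hw⟩ := exists_eq_substZero_add m c
  have h0 := congrArg (substZero m) h
  simp only [map_add, map_mul, substZero_X_self, substZero_X_of_ne him, substZero_X_of_ne hjm,
    substZero_X_of_ne hlm, map_zero, mul_zero, add_zero] at h0
  obtain ⟨p, q, r, ha, hb, hc⟩ := koszul_three hij hil hjl h0
  rw [ha] at hu
  rw [hb] at hv
  rw [hc] at hw
  refine ⟨p, q, r, u, v, w, by rw [hu]; ring, by rw [hv]; ring, by rw [hw]; ring,
    mul_right_cancel₀ (X_ne_zero m) ?_⟩
  rw [hu, hv, hw] at h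
  linear_combination h

end SubstZero

/-- In a unique factorization domain, a vector parallel to a vector with coprime entries is a
multiple of it. -/
lemma exists_eq_mul_of_parallel {R : Type*} [CommRing R] [IsDomain R]
    [UniqueFactorizationMonoid R] {c₁ c₂ c₃ w₁ w₂ w₃ : R} (hc : c₁ ≠ 0)
    (hgcd : ∀ d, d ∣ c₁ → d ∣ c₂ → d ∣ c₃ → IsUnit d)
    (h₁₂ : w₁ * c₂ = w₂ * c₁) (h₁₃ : w₁ * c₃ = w₃ * c₁) :
    ∃ a, w₁ = a * c₁ ∧ w₂ = a * c₂ ∧ w₃ = a * c₃ := by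
  classical
  let _ := UniqueFactorizationMonoid.toGCDMonoid R
  have hu : IsUnit (gcd c₁ (gcd c₂ c₃)) :=
    hgcd _ (gcd_dvd_left _ _) ((gcd_dvd_right _ _).trans (gcd_dvd_left _ _))
      ((gcd_dvd_right _ _).trans (gcd_dvd_right _ _))
  have hdvd : c₁ ∣ gcd (w₁ * c₁) (w₁ * gcd c₂ c₃) :=
    dvd_gcd (dvd_mul_left _ _) ((dvd_gcd (h₁₂ ▸ dvd_mul_left _ _)
      (h₁₃ ▸ dvd_mul_left _ _)).trans (gcd_mul_left' w₁ c₂ c₃).dvd)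
  have hdvd' : c₁ ∣ w₁ := by
    have := hdvd.trans (gcd_mul_left' w₁ c₁ (gcd c₂ c₃)).dvd
    exact (hu.dvd_mul_right).mp this
  obtain ⟨a, rfl⟩ := hdvd'
  refine ⟨a, mul_comm _ _, mul_right_cancel₀ hc ?_, mul_right_cancel₀ hc ?_⟩
  · linear_combination -h₁₂
  · linear_combination -h₁₃

/-! ### The ideal of Sylvester forms -/

/-- The ideal `(f, g, h₁, h₂, c₁, c₂, c₄, F)` attached to `f = s²x + sty + t²z` and
`g = s³A + s²tB + st²C + t³D`. -/
def sylvesterIdeal {R : Type*} [CommRing R] (s t x y z A B C D : R) : Ideal R :=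
  Ideal.span {
    s ^ 2 * x + s * t * y + t ^ 2 * z,
    s ^ 3 * A + s ^ 2 * t * B + s * t ^ 2 * C + t ^ 3 * D,
    -(y * A) * s ^ 2 + (x * C - y * B - z * A) * (s * t) + (x * D - z * B) * t ^ 2,
    (x * C - z * A) * s ^ 2 + (x * D + y * C - z * B) * (s * t) + y * D * t ^ 2,
    x ^ 2 * (C * s + D * t) - x * y * B * s - x * z * (A * s + B * t) + y * z * A * t +
      y ^ 2 * A * s,
    x ^ 2 * D * s + x * y * D * t - x * z * (B * s + C * t) + y * z * A * s + z ^ 2 * A * t,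
    x * y * D * s + y ^ 2 * D * t - x * z * (C * s + D * t) - y * z * C * t +
      z ^ 2 * (A * s + B * t),
    -(x ^ 3 * D ^ 2) + x ^ 2 * y * C * D - x * y ^ 2 * B * D +
      x ^ 2 * z * (2 * B * D - C ^ 2) + x * z ^ 2 * (2 * A * C - B ^ 2) +
      x * y * z * (B * C - 3 * A * D) - y ^ 2 * z * A * C + y * z ^ 2 * A * B +
      y ^ 3 * A * D - z ^ 3 * A ^ 2}

lemma mem_sylvesterIdeal {R : Type*} [CommRing R] {s t x y z A B C D P : R} :
    P ∈ sylvesterIdeal s t x y z A B C D ↔ ∃ u₁ u₂ b₁ b₂ v₁ v₂ v₄ w,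
      P = u₁ * (s ^ 2 * x + s * t * y + t ^ 2 * z) +
        u₂ * (s ^ 3 * A + s ^ 2 * t * B + s * t ^ 2 * C + t ^ 3 * D) +
        b₁ * (-(y * A) * s ^ 2 + (x * C - y * B - z * A) * (s * t) + (x * D - z * B) * t ^ 2) +
        b₂ * ((x * C - z * A) * s ^ 2 + (x * D + y * C - z * B) * (s * t) + y * D * t ^ 2) +
        v₁ * (x ^ 2 * (C * s + D * t) - x * y * B * s - x * z * (A * s + B * t) +
          y * z * A * t + y ^ 2 * A * s) +
        v₂ * (x ^ 2 * D * s + x * y * D * t - x * z * (B * s + C * t) + y * z * A * s +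
          z ^ 2 * A * t) +
        v₄ * (x * y * D * s + y ^ 2 * D * t - x * z * (C * s + D * t) - y * z * C * t +
          z ^ 2 * (A * s + B * t)) +
        w * (-(x ^ 3 * D ^ 2) + x ^ 2 * y * C * D - x * y ^ 2 * B * D +
          x ^ 2 * z * (2 * B * D - C ^ 2) + x * z ^ 2 * (2 * A * C - B ^ 2) +
          x * y * z * (B * C - 3 * A * D) - y ^ 2 * z * A * C + y * z ^ 2 * A * B +
          y ^ 3 * A * D - z ^ 3 * A ^ 2) := by
  simp only [sylvesterIdeal, Ideal.mem_span_insert, Ideal.mem_span_singleton']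
  constructor
  · rintro ⟨u₁, _, ⟨u₂, _, ⟨b₁, _, ⟨b₂, _, ⟨v₁, _, ⟨v₂, _, ⟨v₄, _, ⟨w, rfl⟩,
      rfl⟩, rfl⟩, rfl⟩, rfl⟩, rfl⟩, rfl⟩, rfl⟩
    exact ⟨u₁, u₂, b₁, b₂, v₁, v₂, v₄, w, by ring⟩
  · rintro ⟨u₁, u₂, b₁, b₂, v₁, v₂, v₄, w, rfl⟩
    exact ⟨u₁, _, ⟨u₂, _, ⟨b₁, _, ⟨b₂, _, ⟨v₁, _, ⟨v₂, _, ⟨v₄, _, ⟨w, rfl⟩,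
      rfl⟩, rfl⟩, rfl⟩, rfl⟩, rfl⟩, rfl⟩, by ring⟩

/-- A prime ideal containing `f` and `g` but not `s` contains all the Sylvester forms. -/
lemma sylvesterIdeal_le_of_isPrime {R : Type*} [CommRing R] {s t x y z A B C D : R}
    {K : Ideal R} [hK : K.IsPrime] (hs : s ∉ K)
    (hf : s ^ 2 * x + s * t * y + t ^ 2 * z ∈ K)
    (hg : s ^ 3 * A + s ^ 2 * t * B + s * t ^ 2 * C + t ^ 3 * D ∈ K) :
    sylvesterIdeal s t x y z A B C D ≤ K := by
  have key : ∀ a b : R, b ∈ K → s * a = b → a ∈ K := fun a b hb hab =>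
    (hK.mem_or_mem (hab ▸ hb : s * a ∈ K)).resolve_left hs
  have h₂ : (x * C - z * A) * s ^ 2 + (x * D + y * C - z * B) * (s * t) + y * D * t ^ 2 ∈ K :=
    key _ _ (K.add_mem (K.sub_mem (K.mul_mem_left (t * D) hf) (K.mul_mem_left z hg))
      (K.mul_mem_left (s * C) hf)) (by ring)
  have h₁ : -(y * A) * s ^ 2 + (x * C - y * B - z * A) * (s * t) + (x * D - z * B) * t ^ 2 ∈ K :=
    key _ _ (K.sub_mem (K.mul_mem_left t h₂) (K.mul_mem_left y hg)) (by ring)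
  have hc₁ : x ^ 2 * (C * s + D * t) - x * y * B * s - x * z * (A * s + B * t) +
      y * z * A * t + y ^ 2 * A * s ∈ K :=
    key _ _ (K.sub_mem (K.mul_mem_left x h₂)
      (K.mul_mem_left y (K.add_mem h₁ (K.mul_mem_left B hf)))) (by ring)
  have hc₂ : x ^ 2 * D * s + x * y * D * t - x * z * (B * s + C * t) + y * z * A * s +
      z ^ 2 * A * t ∈ K :=
    key _ _ (K.sub_mem (K.mul_mem_left (x * D) hf)
      (K.mul_mem_left z (K.add_mem h₁ (K.mul_mem_left B hf)))) (by ring)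
  have hc₄ : x * y * D * s + y ^ 2 * D * t - x * z * (C * s + D * t) - y * z * C * t +
      z ^ 2 * (A * s + B * t) ∈ K :=
    key _ _ (K.sub_mem (K.mul_mem_left (y * D) hf) (K.mul_mem_left z h₂)) (by ring)
  rw [sylvesterIdeal, Ideal.span_le]
  rintro _ (rfl | rfl | rfl | rfl | rfl | rfl | rfl | rfl)
  exacts [hf, hg, h₁, h₂, hc₁, hc₂, hc₄,
    key _ _ (K.add_mem (K.add_mem (K.mul_mem_left (y * D - z * C) hc₁)
      (K.mul_mem_left (z * B - x * D) hc₂)) (K.mul_mem_left (-(z * A)) hc₄)) (by ring)]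

section Saturation

variable {k : Type*} [Field k]

/-- Hilbert–Burch: the syzygies of the coefficients of `t` in `c₁, c₂, c₄`, which are the maximal
minors of the matrix with columns `(z, -y, x)` and `(yD - zC, zB - xD, -zA)`. -/
lemma exists_syzygy_eq {R : Type*} [CommRing R] [IsDomain R]
    [UniqueFactorizationMonoid R] {x y z A B C D : R}
    (hyz : ∀ a b : R, a * y + b * z = 0 → ∃ q, a = q * z ∧ b = -q * y) (hz : z ≠ 0)
    (hc : x * (x * D - z * B) + y * z * A ≠ 0)
    (hgcd : ∀ d, d ∣ x * (x * D - z * B) + y * z * A → d ∣ x * y * D - x * z * C + z ^ 2 * A →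
      d ∣ y ^ 2 * D - x * z * D - y * z * C + z ^ 2 * B → IsUnit d)
    {v₁ v₂ v₄ : R}
    (hv : v₁ * (x * (x * D - z * B) + y * z * A) + v₂ * (x * y * D - x * z * C + z ^ 2 * A) +
      v₄ * (y ^ 2 * D - x * z * D - y * z * C + z ^ 2 * B) = 0) :
    ∃ l m, v₁ = m * z + l * (y * D - z * C) ∧ v₂ = -m * y + l * (z * B - x * D) ∧
      v₄ = m * x - l * (z * A) := by
  obtain ⟨a, h₁, h₂, h₃⟩ := exists_eq_mul_of_parallel (w₁ := v₂ * x + v₄ * y)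
    (w₂ := v₄ * z - v₁ * x) (w₃ := -v₁ * y - v₂ * z) hc hgcd
    (by linear_combination x * hv) (by linear_combination y * hv)
  obtain ⟨m, hm₁, hm₂⟩ := hyz (v₁ + a * (y * D - z * C)) (v₂ + a * (z * B - x * D))
    (by linear_combination -h₃)
  refine ⟨-a, m, by linear_combination hm₁, by linear_combination hm₂,
    mul_right_cancel₀ hz ?_⟩
  linear_combination h₂ + x * hm₁

/-- The variable `s` is a nonzerodivisor modulo the ideal of Sylvester forms. -/
lemma mem_sylvesterIdeal_of_X_mul_mem {A B C D P : MvPolynomial (Fin 5) k}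
    (hA₀ : substZero 0 A = A) (hB₀ : substZero 0 B = B) (hC₀ : substZero 0 C = C)
    (hD₀ : substZero 0 D = D) (hA₁ : substZero 1 A = A) (hB₁ : substZero 1 B = B)
    (hC₁ : substZero 1 C = C) (hD₁ : substZero 1 D = D)
    (hzD : ¬ X 4 ∣ D)
    (htF : ¬ X 1 ∣ -(X 2 ^ 3 * D ^ 2) + X 2 ^ 2 * X 3 * C * D - X 2 * X 3 ^ 2 * B * D +
      X 2 ^ 2 * X 4 * (2 * B * D - C ^ 2) + X 2 * X 4 ^ 2 * (2 * A * C - B ^ 2) +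
      X 2 * X 3 * X 4 * (B * C - 3 * A * D) - X 3 ^ 2 * X 4 * A * C + X 3 * X 4 ^ 2 * A * B +
      X 3 ^ 3 * A * D - X 4 ^ 3 * A ^ 2)
    (hc : X 2 * (X 2 * D - X 4 * B) + X 3 * X 4 * A ≠ 0)
    (hgcd : ∀ d, d ∣ X 2 * (X 2 * D - X 4 * B) + X 3 * X 4 * A →
      d ∣ X 2 * X 3 * D - X 2 * X 4 * C + X 4 ^ 2 * A →
      d ∣ X 3 ^ 2 * D - X 2 * X 4 * D - X 3 * X 4 * C + X 4 ^ 2 * B → IsUnit d)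
    (h : X 0 * P ∈ sylvesterIdeal (X 0) (X 1) (X 2) (X 3) (X 4) A B C D) :
    P ∈ sylvesterIdeal (X 0) (X 1) (X 2) (X 3) (X 4) A B C D := by
  obtain ⟨u₁, u₂, b₁, b₂, v₁, v₂, v₄, w, hP⟩ := mem_sylvesterIdeal.mp h
  -- reduce the coefficients modulo `s`
  have hσ := congrArg (substZero 0) hP
  obtain ⟨u₁', hu₁⟩ := exists_eq_substZero_add 0 u₁
  obtain ⟨u₂', hu₂⟩ := exists_eq_substZero_add 0 u₂
  obtain ⟨b₁', hb₁⟩ := exists_eq_substZero_add 0 b₁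
  obtain ⟨b₂', hb₂⟩ := exists_eq_substZero_add 0 b₂
  obtain ⟨v₁', hv₁⟩ := exists_eq_substZero_add 0 v₁
  obtain ⟨v₂', hv₂⟩ := exists_eq_substZero_add 0 v₂
  obtain ⟨v₄', hv₄⟩ := exists_eq_substZero_add 0 v₄
  obtain ⟨w', hw⟩ := exists_eq_substZero_add 0 w
  have n10 : substZero 0 (X 1 : MvPolynomial (Fin 5) k) = X 1 := substZero_X_of_ne (by decide)
  have n20 : substZero 0 (X 2 : MvPolynomial (Fin 5) k) = X 2 := substZero_X_of_ne (by decide)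
  have n30 : substZero 0 (X 3 : MvPolynomial (Fin 5) k) = X 3 := substZero_X_of_ne (by decide)
  have n40 : substZero 0 (X 4 : MvPolynomial (Fin 5) k) = X 4 := substZero_X_of_ne (by decide)
  have n21 : substZero 1 (X 2 : MvPolynomial (Fin 5) k) = X 2 := substZero_X_of_ne (by decide)
  have n31 : substZero 1 (X 3 : MvPolynomial (Fin 5) k) = X 3 := substZero_X_of_ne (by decide)
  have n41 : substZero 1 (X 4 : MvPolynomial (Fin 5) k) = X 4 := substZero_X_of_ne (by decide)
  simp only [map_add, map_sub, map_neg, map_mul, map_pow, substZero_X_self, n10, n20, n30, n40,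
    hA₀, hB₀, hC₀, hD₀, map_ofNat] at hσ
  generalize substZero 0 u₁ = U₁ at *
  generalize substZero 0 u₂ = U₂ at *
  generalize substZero 0 b₁ = B₁ at *
  generalize substZero 0 b₂ = B₂ at *
  generalize substZero 0 v₁ = V₁ at *
  generalize substZero 0 v₂ = V₂ at *
  generalize substZero 0 v₄ = V₄ at *
  generalize substZero 0 w = W at *
  have hs : (X 0 : MvPolynomial (Fin 5) k) ≠ 0 := X_ne_zero 0
  have ht : (X 1 : MvPolynomial (Fin 5) k) ≠ 0 := X_ne_zero 1
  have hz : (X 4 : MvPolynomial (Fin 5) k) ≠ 0 := X_ne_zero 4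
  -- eliminate `F`
  obtain ⟨W', rfl⟩ : X 1 ∣ W := by
    refine ((X_prime (i := 1)).dvd_or_dvd ⟨-(U₁ * X 1 * X 4 + U₂ * X 1 ^ 2 * D +
      B₁ * X 1 * (X 2 * D - X 4 * B) + B₂ * X 1 * (X 3 * D) +
      V₁ * (X 2 * (X 2 * D - X 4 * B) + X 3 * X 4 * A) +
      V₂ * (X 2 * X 3 * D - X 2 * X 4 * C + X 4 ^ 2 * A) +
      V₄ * (X 3 ^ 2 * D - X 2 * X 4 * D - X 3 * X 4 * C + X 4 ^ 2 * B)), ?_⟩).resolve_right htF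
    linear_combination -hσ
  -- eliminate the `cᵢ`
  have hrel : (V₁ + W' * (X 4 * B - X 2 * D)) * (X 2 * (X 2 * D - X 4 * B) + X 3 * X 4 * A) +
      (V₂ + W' * (X 2 * C - X 3 * B - X 4 * A)) *
        (X 2 * X 3 * D - X 2 * X 4 * C + X 4 ^ 2 * A) +
      (V₄ + W' * (X 3 * A)) * (X 3 ^ 2 * D - X 2 * X 4 * D - X 3 * X 4 * C + X 4 ^ 2 * B) +
      X 1 * (U₁ * X 4 + B₁ * (X 2 * D - X 4 * B) + B₂ * (X 3 * D) + U₂ * (X 1 * D)) = 0 := by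
    refine mul_right_cancel₀ ht ?_
    linear_combination -hσ
  generalize hV₁ : V₁ + W' * (X 4 * B - X 2 * D) = T₁ at hrel
  generalize hV₂ : V₂ + W' * (X 2 * C - X 3 * B - X 4 * A) = T₂ at hrel
  generalize hV₄ : V₄ + W' * (X 3 * A) = T₄ at hrel
  have hτ := congrArg (substZero 1) hrel
  simp only [map_add, map_sub, map_mul, map_pow, substZero_X_self, n21, n31, n41,
    hA₁, hB₁, hC₁, hD₁, zero_mul, add_zero, map_zero] at hτ
  obtain ⟨l, m, hl₁, hl₂, hl₄⟩ := exists_syzygy_eq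
    (fun a b hab => koszul_two (by decide) hab) hz hc hgcd hτ
  obtain ⟨T₁', hT₁⟩ := exists_eq_substZero_add 1 T₁
  obtain ⟨T₂', hT₂⟩ := exists_eq_substZero_add 1 T₂
  obtain ⟨T₄', hT₄⟩ := exists_eq_substZero_add 1 T₄
  rw [hl₁] at hT₁
  rw [hl₂] at hT₂
  rw [hl₄] at hT₄
  have hrel₂ : (U₁ + T₁' * (X 3 * A) + T₂' * (X 4 * A - X 2 * C) - T₄' * (X 3 * C)) * X 4 +
      (B₁ + T₁' * X 2 - T₄' * X 4) * (X 2 * D - X 4 * B) +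
      (B₂ + T₂' * X 2 + T₄' * X 3) * (X 3 * D) + U₂ * (X 1 * D) = 0 := by
    refine mul_right_cancel₀ ht ?_
    rw [hT₁, hT₂, hT₄] at hrel
    linear_combination hrel
  generalize hU₁ : U₁ + T₁' * (X 3 * A) + T₂' * (X 4 * A - X 2 * C) - T₄' * (X 3 * C) = E₁
    at hrel₂
  generalize hB₁ : B₁ + T₁' * X 2 - T₄' * X 4 = G₁ at hrel₂
  generalize hB₂ : B₂ + T₂' * X 2 + T₄' * X 3 = G₂ at hrel₂
  -- the remaining relation comes from a Koszul relation on `x, y, t, z`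
  obtain ⟨e, he⟩ : X 4 ∣ G₁ * X 2 + G₂ * X 3 + U₂ * X 1 := by
    refine ((X_prime (i := 4)).dvd_or_dvd (Dvd.intro (G₁ * B - E₁) ?_)).resolve_right hzD
    linear_combination -hrel₂
  have hE₁ : E₁ = G₁ * B - D * e := by
    refine mul_right_cancel₀ hz ?_
    linear_combination hrel₂ - D * he
  obtain ⟨p, q, r, a, b, c, h₁, h₂, h₃, h₄⟩ := koszul_four (k := k) (i := (2 : Fin 5)) (j := 3)
    (l := 1) (m := 4) (by decide) (by decide) (by decide) (by decide) (by decide) (by decide)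
    (a := G₁) (b := G₂) (c := U₂) (d := -e) (by linear_combination he)
  obtain rfl : U₁ = E₁ - T₁' * (X 3 * A) - T₂' * (X 4 * A - X 2 * C) + T₄' * (X 3 * C) := by
    linear_combination hU₁
  obtain rfl : B₁ = G₁ - T₁' * X 2 + T₄' * X 4 := by linear_combination hB₁
  obtain rfl : B₂ = G₂ - T₂' * X 2 - T₄' * X 3 := by linear_combination hB₂
  obtain rfl : V₁ = T₁ - W' * (X 4 * B - X 2 * D) := by linear_combination hV₁
  obtain rfl : V₂ = T₂ - W' * (X 2 * C - X 3 * B - X 4 * A) := by linear_combination hV₂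
  obtain rfl : V₄ = T₄ - W' * (X 3 * A) := by linear_combination hV₄
  obtain rfl : e = a * X 2 + b * X 3 + c * X 1 := by linear_combination -h₄
  refine mem_sylvesterIdeal.mpr ⟨u₁' - q * A + c * C, u₂', b₁' + r, b₂' - c, v₁' - p, v₂' - a,
    v₄' - b, w' + l, mul_left_cancel₀ hs ?_⟩
  rw [hP, hu₁, hu₂, hb₁, hb₂, hv₁, hv₂, hv₄, hw, hE₁, hT₁, hT₂, hT₄, h₁, h₂, h₃]
  ring

end Saturation

section Coprime

variable {k : Type*} [Field k]

/-- The coefficients of `t` in `c₁, c₂, c₄` have no common factor, provided that `D` does not vanish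
at `(1, 0, 0)` and that `x²C - xyB + y²A` does not vanish at the point where `D = z = 0`. -/
lemma isUnit_of_dvd_coeffs {a b c d : Fin 3 → k} {A B C' D : MvPolynomial (Fin 5) k}
    (hA : A = C (a 0) * X 2 + C (a 1) * X 3 + C (a 2) * X 4)
    (hB : B = C (b 0) * X 2 + C (b 1) * X 3 + C (b 2) * X 4)
    (hC : C' = C (c 0) * X 2 + C (c 1) * X 3 + C (c 2) * X 4)
    (hD : D = C (d 0) * X 2 + C (d 1) * X 3 + C (d 2) * X 4)
    (hd : d 0 ≠ 0)
    (he : d 1 ^ 2 * (c 0 * d 1 - c 1 * d 0) + d 1 * d 0 * (b 0 * d 1 - b 1 * d 0) +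
      d 0 ^ 2 * (a 0 * d 1 - a 1 * d 0) ≠ 0)
    {π : MvPolynomial (Fin 5) k}
    (h₁ : π ∣ X 2 * (X 2 * D - X 4 * B) + X 3 * X 4 * A)
    (h₂ : π ∣ X 2 * X 3 * D - X 2 * X 4 * C' + X 4 ^ 2 * A)
    (h₄ : π ∣ X 3 ^ 2 * D - X 2 * X 4 * D - X 3 * X 4 * C' + X 4 ^ 2 * B) : IsUnit π := by
  have n2 : substZero 4 (X 2 : MvPolynomial (Fin 5) k) = X 2 := substZero_X_of_ne (by decide)
  have n3 : substZero 4 (X 3 : MvPolynomial (Fin 5) k) = X 3 := substZero_X_of_ne (by decide)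
  have hA' : substZero 4 A = C (a 0) * X 2 + C (a 1) * X 3 := by simp [hA, n2, n3]
  have hB' : substZero 4 B = C (b 0) * X 2 + C (b 1) * X 3 := by simp [hB, n2, n3]
  have hC' : substZero 4 C' = C (c 0) * X 2 + C (c 1) * X 3 := by simp [hC, n2, n3]
  have hD' : substZero 4 D = C (d 0) * X 2 + C (d 1) * X 3 := by simp [hD, n2, n3]
  have hDy : ¬ X 3 ∣ substZero 4 D := by
    rw [hD', X_dvd_iff_substZero_eq_zero, map_add, map_mul, map_mul, substZero_X_self,
      substZero_X_of_ne (by decide), substZero_C, mul_zero, add_zero]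
    exact mul_ne_zero (by simpa using hd) (X_ne_zero 2)
  have hD0 : substZero 4 D ≠ 0 := fun h => hDy (h ▸ dvd_zero _)
  have hx : Prime (X 2 : MvPolynomial (Fin 5) k) := X_prime
  have hy : Prime (X 3 : MvPolynomial (Fin 5) k) := X_prime
  have hz : Prime (X 4 : MvPolynomial (Fin 5) k) := X_prime
  have hq : substZero 4 (X 2 * (X 2 * D - X 4 * B) + X 3 * X 4 * A) =
      X 2 ^ 2 * substZero 4 D := by
    simp only [map_add, map_sub, map_mul, n2, n3, substZero_X_self]; ring
  have hπ₁ : substZero 4 π ∣ X 2 ^ 2 * substZero 4 D := hq ▸ map_dvd (substZero 4) h₁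
  have hπ₄ : substZero 4 π ∣ X 3 ^ 2 * substZero 4 D := by
    have := map_dvd (substZero 4) h₄
    simp only [map_add, map_sub, map_mul, map_pow, n2, n3, substZero_X_self] at this
    convert this using 1; ring
  have hπ0 : substZero 4 π ≠ 0 := fun h => by
    rw [h, zero_dvd_iff] at hπ₁
    exact mul_ne_zero (pow_ne_zero 2 hx.ne_zero) hD0 hπ₁
  have hE : π ∣ X 2 ^ 2 * C' - X 2 * X 3 * B + X 3 ^ 2 * A - X 2 * X 4 * A := by
    have h : π ∣ X 4 * (X 2 ^ 2 * C' - X 2 * X 3 * B + X 3 ^ 2 * A - X 2 * X 4 * A) := by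
      have := dvd_sub (h₁.mul_left (X 3)) (h₂.mul_left (X 2))
      convert this using 1; ring
    obtain ⟨m, hm⟩ := h
    obtain ⟨m', rfl⟩ := (hz.dvd_or_dvd ⟨_, hm.symm⟩).resolve_left fun h =>
      hπ0 ((X_dvd_iff_substZero_eq_zero _ _).mp h)
    exact ⟨m', mul_left_cancel₀ hz.ne_zero (by rw [hm]; ring)⟩
  have hπE := map_dvd (substZero 4) hE
  simp only [map_add, map_sub, map_mul, map_pow, n2, n3, substZero_X_self, mul_zero, zero_mul,
    sub_zero] at hπE
  have hunit : IsUnit (substZero 4 π) := by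
    by_contra hnu
    obtain ⟨r, hr, hrd⟩ := WfDvdMonoid.exists_irreducible_factor hnu hπ0
    have hr : Prime r := hr.prime
    by_cases hrD : r ∣ substZero 4 D
    · have hry : r ∣ C (d 1 ^ 2 * (c 0 * d 1 - c 1 * d 0) + d 1 * d 0 * (b 0 * d 1 - b 1 * d 0) +
          d 0 ^ 2 * (a 0 * d 1 - a 1 * d 0)) * X 3 ^ 3 := by
        have h := dvd_sub (hrD.mul_right (C (c 0) * ((C (d 0) * X 2) ^ 2 -
          C (d 0) * X 2 * (C (d 1) * X 3) + (C (d 1) * X 3) ^ 2) +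
          (C (c 1) - C (b 0)) * C (d 0) * X 3 * (C (d 0) * X 2 - C (d 1) * X 3) +
          (C (a 0) - C (b 1)) * C (d 0) ^ 2 * X 3 ^ 2)) ((hrd.trans hπE).mul_left (C (d 0) ^ 3))
        convert h using 1
        rw [hA', hB', hC', hD']
        simp only [map_add, map_sub, map_mul, map_pow]
        ring
      have hry : r ∣ X 3 := by
        rcases hr.dvd_or_dvd hry with h | h
        · exact absurd (isUnit_of_dvd_unit h ((Ne.isUnit he).map C)) hr.not_isUnit
        · exact hr.dvd_of_dvd_pow h
      exact hDy (((hr.irreducible.dvd_symm hy.irreducible hry)).trans hrD)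
    · have h2 := hr.dvd_of_dvd_pow ((hr.dvd_or_dvd (hrd.trans hπ₁)).resolve_right hrD)
      have h3 := hr.dvd_of_dvd_pow ((hr.dvd_or_dvd (hrd.trans hπ₄)).resolve_right hrD)
      have := (hr.irreducible.dvd_symm hx.irreducible h2).trans h3
      rw [X_dvd_X] at this
      exact absurd this (by decide)
  obtain ⟨m, hm⟩ := h₁
  have hlin : ∀ e : Fin 3 → k, (C (e 0) * X 2 + C (e 1) * X 3 + C (e 2) * X 4 :
      MvPolynomial (Fin 5) k).IsHomogeneous 1 := fun e =>
    (((isHomogeneous_C_mul_X _ _).add (isHomogeneous_C_mul_X _ _)).add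
      (isHomogeneous_C_mul_X _ _))
  have hX : ∀ i, (X i : MvPolynomial (Fin 5) k).IsHomogeneous 1 := isHomogeneous_X k
  have hhom : (X 2 * (X 2 * D - X 4 * B) + X 3 * X 4 * A).IsHomogeneous 3 := by
    rw [hA, hB, hD]
    exact ((hX 2).mul (((hX 2).mul (hlin d)).sub ((hX 4).mul (hlin b)))).add
      (((hX 3).mul (hX 4)).mul (hlin a))
  have hdeg : (X 2 ^ 2 * substZero 4 D).totalDegree = 3 := by
    have h : (X 2 ^ 2 * substZero 4 D).IsHomogeneous 3 := by
      rw [hD']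
      exact ((hX 2).pow 2).mul ((isHomogeneous_C_mul_X _ _).add (isHomogeneous_C_mul_X _ _))
    exact h.totalDegree (mul_ne_zero (pow_ne_zero 2 hx.ne_zero) hD0)
  have hne : π * m ≠ 0 := fun h => by
    rw [← hm] at h
    rw [h, map_zero] at hq
    exact mul_ne_zero (pow_ne_zero 2 hx.ne_zero) hD0 hq.symm
  have hm3 : 3 ≤ m.totalDegree := by
    refine le_trans ?_ (totalDegree_substZero_le 4 m)
    have h0 : substZero 4 π * substZero 4 m = X 2 ^ 2 * substZero 4 D := by
      rw [← map_mul, ← hm, hq]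
    have hm0 : substZero 4 m ≠ 0 := fun h => by
      rw [h, mul_zero] at h0
      exact mul_ne_zero (pow_ne_zero 2 hx.ne_zero) hD0 h0.symm
    rw [← h0, totalDegree_mul_of_isDomain hπ0 hm0,
      (isUnit_iff_totalDegree_of_isReduced.mp hunit).2, zero_add] at hdeg
    exact hdeg.ge
  have hπdeg : π.totalDegree = 0 := by
    have h := totalDegree_mul_of_isDomain (left_ne_zero_of_mul hne) (right_ne_zero_of_mul hne)
    rw [← hm, hhom.totalDegree (hm ▸ hne)] at h
    omega
  obtain ⟨r, hr⟩ : ∃ r, π = C r := ⟨_, totalDegree_eq_zero_iff_eq_C.mp hπdeg⟩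
  rw [hr]
  refine (Ne.isUnit fun h => left_ne_zero_of_mul hne ?_).map C
  rw [hr, h, C_0]

end Coprime

section Height

variable {k : Type*} [Field k]

attribute [local instance] MvPolynomial.gradedAlgebra

lemma ker_constantCoeff_eq_idealOfVars (σ : Type*) :
    RingHom.ker (constantCoeff : MvPolynomial σ k →+* k) = idealOfVars σ k := by
  refine le_antisymm (fun p hp => ?_) (Ideal.span_le.mpr ?_)
  · rw [RingHom.mem_ker, constantCoeff_eq] at hp
    rw [idealOfVars, ← Set.image_univ, mem_ideal_span_X_image]
    intro d hd
    have hd0 : d ≠ 0 := by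
      rintro rfl
      exact mem_support_iff.mp hd hp
    obtain ⟨i, hi⟩ := Finsupp.ne_iff.mp hd0
    exact ⟨i, Set.mem_univ i, hi⟩
  · rintro _ ⟨i, rfl⟩
    simp

/-- A proper homogeneous ideal of a polynomial ring is contained in the ideal of the variables. -/
lemma le_idealOfVars_of_isHomogeneous {σ : Type*} {Q : Ideal (MvPolynomial σ k)}
    (hQ : Q.IsHomogeneous (homogeneousSubmodule σ k)) (hQt : Q ≠ ⊤) :
    Q ≤ idealOfVars σ k := by
  rw [← ker_constantCoeff_eq_idealOfVars]
  intro p hp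
  have h0 := (mem_iff_homogeneousComponent_mem hQ p).mp hp 0
  rw [homogeneousComponent_zero] at h0
  by_contra h
  exact hQt (Ideal.eq_top_of_isUnit_mem _ h0 ((Ne.isUnit h).map C))

/-- An ideal of height two generated by forms in two variables contains a power of each
variable. -/
lemma exists_X_pow_mem_of_heightOf_eq_two {ι : Type*} {f : ι → MvPolynomial (Fin 2) k} {n : ℕ}
    (hf : ∀ j, (f j).IsHomogeneous n) (hht : (Ideal.span (Set.range f)).heightOf = 2)
    (i : Fin 2) : ∃ N, (X i : MvPolynomial (Fin 2) k) ^ N ∈ Ideal.span (Set.range f) := by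
  have hI : (Ideal.span (Set.range f)).IsHomogeneous (homogeneousSubmodule (Fin 2) k) := by
    refine Ideal.homogeneous_span _ _ ?_
    rintro _ ⟨j, rfl⟩
    exact ⟨n, hf j⟩
  generalize Ideal.span (Set.range f) = I at *
  change X i ∈ I.radical
  rw [Ideal.radical_eq_sInf, Submodule.mem_sInf]
  rintro Q ⟨hIQ, hQ⟩
  by_contra hXQ
  let Q' := (Ideal.homogeneousCore (homogeneousSubmodule (Fin 2) k) Q).toIdeal
  have hQ'Q : Q' ≤ Q := Ideal.toIdeal_homogeneousCore_le _ Q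
  have hIQ' : I ≤ Q' := by
    rw [← hI.toIdeal_homogeneousCore_eq_self]
    exact Ideal.homogeneousCore_mono _ hIQ
  have hQ' : Q'.IsPrime := hQ.homogeneousCore
  have hM : (idealOfVars (Fin 2) k).IsPrime := by
    rw [← ker_constantCoeff_eq_idealOfVars]
    exact RingHom.ker_isPrime _
  have hlt : Q' < idealOfVars (Fin 2) k := by
    refine lt_of_le_of_ne (le_idealOfVars_of_isHomogeneous
      (HomogeneousIdeal.isHomogeneous _) hQ'.ne_top) fun h => hXQ (hQ'Q ?_)
    rw [h]
    exact Ideal.subset_span ⟨i, rfl⟩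
  have h2 : 2 ≤ Q'.height := by
    rw [← hht]
    change _ ≤ (⟨Q', hQ'⟩ : PrimeSpectrum (MvPolynomial (Fin 2) k)).asIdeal.height
    rw [PrimeSpectrum.height_eq_orderHeight]
    exact iInf₂_le (⟨Q', hQ'⟩ : PrimeSpectrum (MvPolynomial (Fin 2) k)) hIQ'
  have h3 := Ideal.height_add_one_le_of_lt_of_isPrime hlt
  have h4 : (idealOfVars (Fin 2) k).height ≤ 2 := by
    refine (Ideal.height_le_spanFinrank _ hM.ne_top).trans ?_
    refine Nat.cast_le.mpr ((Submodule.spanFinrank_span_le_ncard_of_finite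
      (Set.finite_range _)).trans ?_)
    rw [Set.ncard_range_of_injective (X_injective), Nat.card_fin]
  have : (2 : ℕ∞) + 1 ≤ 2 := (add_le_add_left h2 1).trans (h3.trans h4)
  exact absurd this (by decide)

end Height

section Rees

variable {k : Type*} [Field k]

/-- Away from `s`, the kernel of the Rees presentation is generated by the Koszul relations
`fᵢxⱼ - fⱼxᵢ`. -/
lemma exists_X_pow_mul_mem_of_mem_ker {f : Fin 3 → MvPolynomial (Fin 2) k} {N : ℕ}
    (hN : X 0 ^ N ∈ Ideal.span (Set.range f)) {J : Ideal (MvPolynomial (Fin 5) k)}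
    (hJ : ∀ i j : Fin 3, rename (Fin.castLE (by decide)) (f i) * X (Fin.natAdd 2 j) -
      rename (Fin.castLE (by decide)) (f j) * X (Fin.natAdd 2 i) ∈ J)
    {P : MvPolynomial (Fin 5) k} (hP : P ∈ RingHom.ker (reesPresentation k f)) :
    ∃ M, X 0 ^ M * P ∈ J := by
  obtain ⟨a, ha⟩ := Ideal.mem_span_range_iff_exists_fun.mp hN
  let ι : MvPolynomial (Fin 2) k →+* MvPolynomial (Fin 5) k :=
    (rename (Fin.castLE (by decide)) : MvPolynomial (Fin 2) k →ₐ[k] MvPolynomial (Fin 5) k)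
  let s : MvPolynomial (Fin 5) k ⧸ J := Ideal.Quotient.mk J (X 0)
  let ρ : MvPolynomial (Fin 5) k →+* Localization.Away s :=
    (algebraMap _ (Localization.Away s)).comp (Ideal.Quotient.mk J)
  have hρs : ρ (X 0) * IsLocalization.Away.invSelf s = 1 :=
    IsLocalization.Away.mul_invSelf s
  let L : MvPolynomial (Fin 5) k := ∑ i, ι (a i) * X (Fin.natAdd 2 i)
  have hL : ∀ j : Fin 3, ρ (ι (f j)) * ρ L = ρ (X 0 ^ N) * ρ (X (Fin.natAdd 2 j)) := by
    intro j
    have h : ι (X 0) = X 0 := rename_X _ _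
    rw [← map_mul, ← map_mul, ← sub_eq_zero, ← map_sub]
    have hmem : ι (f j) * L - X 0 ^ N * X (Fin.natAdd 2 j) ∈ J := by
      rw [← h, ← map_pow, ← ha, map_sum, Finset.sum_mul, Finset.mul_sum,
        ← Finset.sum_sub_distrib]
      refine J.sum_mem fun i _ => ?_
      convert J.mul_mem_left (ι (a i)) (hJ j i) using 1
      rw [map_mul]
      change _ = ι (a i) * (ι (f j) * _ - ι (f i) * _)
      ring
    rw [RingHom.comp_apply, Ideal.Quotient.eq_zero_iff_mem.mpr hmem, map_zero]
  let ψ : Polynomial (MvPolynomial (Fin 2) k) →+* Localization.Away s :=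
    Polynomial.eval₂RingHom (ρ.comp ι) (ρ L * IsLocalization.Away.invSelf s ^ N)
  have hψ : ψ.comp (reesPresentation k f : MvPolynomial (Fin 5) k →+* _) = ρ := by
    have hx : ∀ j : Fin 3, ψ (Polynomial.C (f j) * Polynomial.X) = ρ (X (Fin.natAdd 2 j)) := by
      intro j
      simp only [ψ, map_mul, Polynomial.coe_eval₂RingHom, Polynomial.eval₂_C,
        Polynomial.eval₂_X, RingHom.comp_apply, ← mul_assoc, hL]
      rw [mul_right_comm, map_pow, ← mul_pow, hρs, one_pow, one_mul]
    refine MvPolynomial.ringHom_ext (fun c => ?_) fun i => ?_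
    · simp [ψ, reesPresentation, ι, Polynomial.algebraMap_apply, MvPolynomial.algebraMap_eq]
    · fin_cases i
      · simp [ψ, reesPresentation, ι]
      · simp [ψ, reesPresentation, ι]
      · simpa [reesPresentation] using hx 0
      · simpa [reesPresentation] using hx 1
      · simpa [reesPresentation] using hx 2
  have h0 : ρ P = 0 := by
    rw [← hψ, RingHom.comp_apply]
    erw [RingHom.mem_ker.mp hP]
    exact map_zero ψ
  obtain ⟨⟨_, M, rfl⟩, hM⟩ := (IsLocalization.map_eq_zero_iff (Submonoid.powers s)
    (Localization.Away s) (Ideal.Quotient.mk J P)).mp h0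
  refine ⟨M, Ideal.Quotient.eq_zero_iff_mem.mp ?_⟩
  simpa [s] using hM

end Rees

set_option maxHeartbeats 1000000 in
/-- degree 5, column degrees 2 and 3, generic case.  For a generic
choice of the twelve parameters giving the linear forms `A, B, C, D` (i.e. on a nonempty
Zariski-open set of parameters, here: the nonvanishing locus of some nonzero polynomial
`p`), for the ideal `I` with Hilbert–Burch matrix with columns `(s², st, t²)ᵗ` and
`(g-column)` determined by `g = s³A + s²tB + st²C + t³D`, the defining ideal of the Rees
algebra `R[It]` in `S = R[x,y,z]` equals `(f, g, h₁, h₂, c₁, c₂, c₄, F)` with the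
indicated Sylvester forms. -/
theorem rees_defining_ideal_deg5_balanced_generic
    (k : Type*) [Field k] [Infinite k] :
    ∃ p : MvPolynomial (Fin 4 × Fin 3) k, p ≠ 0 ∧
      ∀ c : Fin 4 × Fin 3 → k, eval c p ≠ 0 →
        ∀ (φ : Matrix (Fin 3) (Fin 2) (MvPolynomial (Fin 2) k)),
          (φ 0 0 = X 0 ^ 2 ∧ φ 1 0 = X 0 * X 1 ∧ φ 2 0 = X 1 ^ 2) →
          (∀ i, φ i 1 =
            C (c (0, i)) * X 0 ^ 3 + C (c (1, i)) * (X 0 ^ 2 * X 1) +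
            C (c (2, i)) * (X 0 * X 1 ^ 2) + C (c (3, i)) * X 1 ^ 3) →
          ∀ f : Fin 3 → MvPolynomial (Fin 2) k,
          (∀ j, f j = (-1) ^ (j : ℕ) * (φ.submatrix j.succAbove id).det) →
          ∀ I : Ideal (MvPolynomial (Fin 2) k), I = Ideal.span (Set.range f) →
          I.heightOf = 2 →
          (¬ ∃ g₁ g₂ : MvPolynomial (Fin 2) k, I = Ideal.span {g₁, g₂}) →
          let AS : MvPolynomial (Fin 5) k :=
            C (c (0, 0)) * X 2 + C (c (0, 1)) * X 3 + C (c (0, 2)) * X 4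
          let BS : MvPolynomial (Fin 5) k :=
            C (c (1, 0)) * X 2 + C (c (1, 1)) * X 3 + C (c (1, 2)) * X 4
          let CS : MvPolynomial (Fin 5) k :=
            C (c (2, 0)) * X 2 + C (c (2, 1)) * X 3 + C (c (2, 2)) * X 4
          let DS : MvPolynomial (Fin 5) k :=
            C (c (3, 0)) * X 2 + C (c (3, 1)) * X 3 + C (c (3, 2)) * X 4
          RingHom.ker (reesPresentation k f) =
            Ideal.span {
              X 0 ^ 2 * X 2 + X 0 * X 1 * X 3 + X 1 ^ 2 * X 4,
              X 0 ^ 3 * AS + X 0 ^ 2 * X 1 * BS + X 0 * X 1 ^ 2 * CS + X 1 ^ 3 * DS,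
              -(X 3 * AS) * X 0 ^ 2 + (X 2 * CS - X 3 * BS - X 4 * AS) * (X 0 * X 1) +
                (X 2 * DS - X 4 * BS) * X 1 ^ 2,
              (X 2 * CS - X 4 * AS) * X 0 ^ 2 +
                (X 2 * DS + X 3 * CS - X 4 * BS) * (X 0 * X 1) + X 3 * DS * X 1 ^ 2,
              X 2 ^ 2 * (CS * X 0 + DS * X 1) - X 2 * X 3 * BS * X 0 -
                X 2 * X 4 * (AS * X 0 + BS * X 1) + X 3 * X 4 * AS * X 1 +
                X 3 ^ 2 * AS * X 0,
              X 2 ^ 2 * DS * X 0 + X 2 * X 3 * DS * X 1 -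
                X 2 * X 4 * (BS * X 0 + CS * X 1) + X 3 * X 4 * AS * X 0 +
                X 4 ^ 2 * AS * X 1,
              X 2 * X 3 * DS * X 0 + X 3 ^ 2 * DS * X 1 -
                X 2 * X 4 * (CS * X 0 + DS * X 1) - X 3 * X 4 * CS * X 1 +
                X 4 ^ 2 * (AS * X 0 + BS * X 1),
              -(X 2 ^ 3 * DS ^ 2) + X 2 ^ 2 * X 3 * CS * DS - X 2 * X 3 ^ 2 * BS * DS +
                X 2 ^ 2 * X 4 * (2 * BS * DS - CS ^ 2) +
                X 2 * X 4 ^ 2 * (2 * AS * CS - BS ^ 2) +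
                X 2 * X 3 * X 4 * (BS * CS - 3 * AS * DS) - X 3 ^ 2 * X 4 * AS * CS +
                X 3 * X 4 ^ 2 * AS * BS + X 3 ^ 3 * AS * DS - X 4 ^ 3 * AS ^ 2} := by
  let q : Fin 4 × Fin 3 → MvPolynomial (Fin 4 × Fin 3) k := X
  refine ⟨q (3, 0) * (q (3, 1) ^ 2 * (q (2, 0) * q (3, 1) - q (2, 1) * q (3, 0)) +
    q (3, 1) * q (3, 0) * (q (1, 0) * q (3, 1) - q (1, 1) * q (3, 0)) +
    q (3, 0) ^ 2 * (q (0, 0) * q (3, 1) - q (0, 1) * q (3, 0))), ?_, ?_⟩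
  · intro h
    have := congrArg (eval fun i : Fin 4 × Fin 3 => if i = (3, 0) ∨ i = (0, 1) then (1 : k) else 0) h
    simp [q] at this
  intro c hp φ hφ₁ hφ₂ f hf I hI hht _ A B C' D
  have hd : c (3, 0) ≠ 0 := fun h => hp (by simp [q, h])
  have he : c (3, 1) ^ 2 * (c (2, 0) * c (3, 1) - c (2, 1) * c (3, 0)) +
      c (3, 1) * c (3, 0) * (c (1, 0) * c (3, 1) - c (1, 1) * c (3, 0)) +
      c (3, 0) ^ 2 * (c (0, 0) * c (3, 1) - c (0, 1) * c (3, 0)) ≠ 0 := fun h => hp (by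
    simp only [q, map_mul, map_add, map_sub, map_pow, eval_X, h, mul_zero])
  change RingHom.ker (reesPresentation k f) =
    sylvesterIdeal (X 0) (X 1) (X 2) (X 3) (X 4) A B C' D
  have hf₀ : f 0 = φ 1 0 * φ 2 1 - φ 2 0 * φ 1 1 := by
    rw [hf, Matrix.det_fin_two]; simp; ring
  have hf₁ : f 1 = φ 2 0 * φ 0 1 - φ 0 0 * φ 2 1 := by
    rw [hf, Matrix.det_fin_two]; simp [Fin.succAbove]; ring
  have hf₂ : f 2 = φ 0 0 * φ 1 1 - φ 1 0 * φ 0 1 := by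
    rw [hf, Matrix.det_fin_two]; simp [Fin.succAbove]; ring
  have hsyz₀ : φ 0 0 * f 0 + φ 1 0 * f 1 + φ 2 0 * f 2 = 0 := by rw [hf₀, hf₁, hf₂]; ring
  have hsyz₁ : φ 0 1 * f 0 + φ 1 1 * f 1 + φ 2 1 * f 2 = 0 := by rw [hf₀, hf₁, hf₂]; ring
  obtain ⟨h00, h10, h20⟩ := hφ₁
  apply le_antisymm
  · intro P hP
    have hφhom : ∀ i, (φ i 0).IsHomogeneous 2 ∧ (φ i 1).IsHomogeneous 3 := by
      have hX : ∀ i, (X i : MvPolynomial (Fin 2) k).IsHomogeneous 1 := isHomogeneous_X k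
      have hC : ∀ a, (C a : MvPolynomial (Fin 2) k).IsHomogeneous 0 := isHomogeneous_C _
      refine fun i => ⟨?_, ?_⟩
      · fin_cases i
        · exact h00 ▸ (hX 0).pow 2
        · exact h10 ▸ (hX 0).mul (hX 1)
        · exact h20 ▸ (hX 1).pow 2
      · rw [hφ₂]
        exact ((((hC _).mul ((hX 0).pow 3)).add ((hC _).mul (((hX 0).pow 2).mul (hX 1)))).add
          ((hC _).mul ((hX 0).mul ((hX 1).pow 2)))).add ((hC _).mul ((hX 1).pow 3))
    have hfhom : ∀ j, (f j).IsHomogeneous 5 := by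
      intro j
      fin_cases j
      · exact hf₀ ▸ ((hφhom 1).1.mul (hφhom 2).2).sub ((hφhom 2).1.mul (hφhom 1).2)
      · exact hf₁ ▸ ((hφhom 2).1.mul (hφhom 0).2).sub ((hφhom 0).1.mul (hφhom 2).2)
      · exact hf₂ ▸ ((hφhom 0).1.mul (hφhom 1).2).sub ((hφhom 1).1.mul (hφhom 0).2)
    obtain ⟨N, hN⟩ := exists_X_pow_mem_of_heightOf_eq_two hfhom (hI ▸ hht) 0
    obtain ⟨M, hM⟩ : ∃ M, X 0 ^ M * P ∈
        sylvesterIdeal (X 0) (X 1) (X 2) (X 3) (X 4) A B C' D := by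
      refine exists_X_pow_mul_mem_of_mem_ker hN ?_ hP
      let r : MvPolynomial (Fin 2) k →ₐ[k] MvPolynomial (Fin 5) k :=
        rename (Fin.castLE (by decide))
      have hr₀ : r (X 0) = X 0 := rename_X _ _
      have hr₁ : r (X 1) = X 1 := rename_X _ _
      have hrC : ∀ a, r (C a) = C a := fun a => rename_C _ a
      have hF : r (φ 0 0) * X 2 + r (φ 1 0) * X 3 + r (φ 2 0) * X 4 ∈
          sylvesterIdeal (X 0) (X 1) (X 2) (X 3) (X 4) A B C' D := by
        refine Ideal.subset_span (.inl ?_)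
        simp only [h00, h10, h20, map_mul, map_pow, hr₀, hr₁]
      have hG : r (φ 0 1) * X 2 + r (φ 1 1) * X 3 + r (φ 2 1) * X 4 ∈
          sylvesterIdeal (X 0) (X 1) (X 2) (X 3) (X 4) A B C' D := by
        refine Ideal.subset_span (.inr (.inl ?_))
        simp only [hφ₂, map_add, map_mul, map_pow, hr₀, hr₁, hrC, A, B, C', D]
        ring
      have hmem := fun i => Ideal.sub_mem _ (Ideal.mul_mem_left _ (r (φ i 1)) hF)
        (Ideal.mul_mem_left _ (r (φ i 0)) hG)
      have h₀₁ : r (f 0) * X 3 - r (f 1) * X 2 ∈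
          sylvesterIdeal (X 0) (X 1) (X 2) (X 3) (X 4) A B C' D := by
        convert hmem 2 using 1
        simp only [hf₀, hf₁, map_sub, map_mul]; ring
      have h₁₂ : r (f 1) * X 4 - r (f 2) * X 3 ∈
          sylvesterIdeal (X 0) (X 1) (X 2) (X 3) (X 4) A B C' D := by
        convert hmem 0 using 1
        simp only [hf₁, hf₂, map_sub, map_mul]; ring
      have h₂₀ : r (f 2) * X 2 - r (f 0) * X 4 ∈
          sylvesterIdeal (X 0) (X 1) (X 2) (X 3) (X 4) A B C' D := by
        convert hmem 1 using 1
        simp only [hf₀, hf₂, map_sub, map_mul]; ring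
      intro i j
      fin_cases i <;> fin_cases j
      exacts [(sub_self (r (f 0) * X 2)).symm ▸ Ideal.zero_mem _, h₀₁,
        neg_sub (r (f 2) * X 2) (r (f 0) * X 4) ▸ neg_mem h₂₀,
        neg_sub (r (f 0) * X 3) (r (f 1) * X 2) ▸ neg_mem h₀₁,
        (sub_self (r (f 1) * X 3)).symm ▸ Ideal.zero_mem _, h₁₂, h₂₀,
        neg_sub (r (f 1) * X 4) (r (f 2) * X 3) ▸ neg_mem h₁₂,
        (sub_self (r (f 2) * X 4)).symm ▸ Ideal.zero_mem _]
    have hn : ∀ i j, i ≠ j → substZero i (X j : MvPolynomial (Fin 5) k) = X j :=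
      fun i j h => substZero_X_of_ne h.symm
    have hlin : ∀ (i : Fin 5), i = 0 ∨ i = 1 → ∀ j,
        substZero i (C (c (j, 0)) * X 2 + C (c (j, 1)) * X 3 + C (c (j, 2)) * X 4) =
        (C (c (j, 0)) * X 2 + C (c (j, 1)) * X 3 + C (c (j, 2)) * X 4 :
          MvPolynomial (Fin 5) k) := by
      rintro i (rfl | rfl) j <;>
      simp only [map_add, map_mul, substZero_C] <;>
      rw [hn _ 2 (by decide), hn _ 3 (by decide), hn _ 4 (by decide)]
    have hD : eval (fun i : Fin 5 => if i = 2 then (1 : k) else 0) D = c (3, 0) := by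
      simp [D]
    induction M with
    | zero => simpa using hM
    | succ M ih =>
      refine ih (mem_sylvesterIdeal_of_X_mul_mem (hlin 0 (.inl rfl) 0) (hlin 0 (.inl rfl) 1)
        (hlin 0 (.inl rfl) 2) (hlin 0 (.inl rfl) 3) (hlin 1 (.inr rfl) 0) (hlin 1 (.inr rfl) 1)
        (hlin 1 (.inr rfl) 2) (hlin 1 (.inr rfl) 3) ?_ ?_ ?_ ?_ ?_)
      · rintro ⟨m, hm⟩
        have h := congrArg (eval fun i : Fin 5 => if i = 2 then (1 : k) else 0) hm
        rw [hD] at h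
        exact hd (by simpa using h)
      · rintro ⟨m, hm⟩
        have h := congrArg (eval fun i : Fin 5 => if i = 2 then (1 : k) else 0) hm
        simp [hD, hd] at h
      · intro hm
        have h := congrArg (eval fun i : Fin 5 => if i = 2 then (1 : k) else 0) hm
        simp [hD, hd] at h
      · exact fun d => isUnit_of_dvd_coeffs (a := fun i => c (0, i)) (b := fun i => c (1, i))
          (c := fun i => c (2, i)) (d := fun i => c (3, i)) rfl rfl rfl rfl hd he
      · rw [← mul_assoc, ← pow_succ']
        exact hM
  · have hK : (RingHom.ker (reesPresentation k f)).IsPrime := RingHom.ker_isPrime _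
    have hlin : ∀ j, reesPresentation k f
        (C (c (j, 0)) * X 2 + C (c (j, 1)) * X 3 + C (c (j, 2)) * X 4) =
        Polynomial.C (C (c (j, 0)) * f 0 + C (c (j, 1)) * f 1 + C (c (j, 2)) * f 2) *
          Polynomial.X := by
      intro j
      simp [reesPresentation, Polynomial.algebraMap_apply, MvPolynomial.algebraMap_eq]
      ring
    refine sylvesterIdeal_le_of_isPrime (fun h => ?_) ?_ ?_
    · rw [RingHom.mem_ker] at h
      simp [reesPresentation] at h
    · rw [h00, h10, h20] at hsyz₀
      have h := congrArg (fun p => Polynomial.C p * Polynomial.X) hsyz₀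
      simp only [map_add, map_mul, map_pow, map_zero, zero_mul] at h
      rw [RingHom.mem_ker]
      simp [reesPresentation]
      linear_combination h
    · rw [hφ₂, hφ₂, hφ₂] at hsyz₁
      have h := congrArg (fun p => Polynomial.C p * Polynomial.X) hsyz₁
      simp only [map_add, map_mul, map_pow, map_zero, zero_mul] at h
      rw [RingHom.mem_ker]
      simp only [A, B, C', D, map_add, map_mul, map_pow] at hlin ⊢
      simp only [hlin]
      simp [reesPresentation]
      linear_combination h
end

section
/- Let k be a field and n ≥ 1. In the polynomial ring k[s,t], the ideal (s,t)^n admits the irreducible decomposition (s,t)^n = ⋂_{i=1}^{n} (s^i, t^{n+1−i}); moreover each ideal (s^i, t^{n+1−i}) is irreducible. -/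
open MvPolynomial

namespace MvPolynomial

lemma mem_span_X_pow_pair_iff {R : Type*} [CommRing R] {a b : ℕ} {p : MvPolynomial (Fin 2) R} :
    p ∈ Ideal.span {(X 0 : MvPolynomial (Fin 2) R) ^ a, (X 1 : MvPolynomial (Fin 2) R) ^ b} ↔
      ∀ m ∈ p.support, a ≤ m 0 ∨ b ≤ m 1 := by
  have h := mem_ideal_span_monomial_image (x := p)
    (s := {Finsupp.single 0 a, Finsupp.single 1 b})
  simpa [Set.image_pair, ← X_pow_eq_monomial] using h

lemma mem_span_X_pair_pow_iff {R : Type*} [CommRing R] {n : ℕ} {p : MvPolynomial (Fin 2) R} :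
    p ∈ (Ideal.span {X 0, X 1} : Ideal (MvPolynomial (Fin 2) R)) ^ n ↔
      ∀ m ∈ p.support, n ≤ m 0 + m 1 := by
  have h : (Ideal.span {X 0, X 1} : Ideal (MvPolynomial (Fin 2) R)) = idealOfVars (Fin 2) R := by
    rw [idealOfVars]
    congr 1
    ext
    simp [Fin.exists_fin_two, eq_comm]
  rw [h, mem_pow_idealOfVars_iff]
  simp [Finsupp.degree_eq_sum]

/-- The monomial `s ^ a * t ^ b` generates the socle of `k[s,t] / (s ^ (a + 1), t ^ (b + 1))`. -/
lemma monomial_mem_of_span_X_pow_pair_lt {k : Type*} [Field k] {a b : ℕ}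
    {I : Ideal (MvPolynomial (Fin 2) k)}
    (hI : Ideal.span {(X 0 : MvPolynomial (Fin 2) k) ^ (a + 1),
      (X 1 : MvPolynomial (Fin 2) k) ^ (b + 1)} < I) :
    monomial (Finsupp.single 0 a + Finsupp.single 1 b) (1 : k) ∈ I := by
  obtain ⟨hle, f, hfI, hf⟩ := SetLike.lt_iff_le_and_exists.mp hI
  rw [mem_span_X_pow_pair_iff] at hf
  push Not at hf
  obtain ⟨m, ⟨hm, hma, hmb⟩, hmin⟩ :=
    exists_minimal_of_wellFoundedLT
      (fun m : Fin 2 →₀ ℕ ↦ m ∈ f.support ∧ m 0 < a + 1 ∧ m 1 < b + 1) hf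
  set c : Fin 2 →₀ ℕ := Finsupp.single 0 a + Finsupp.single 1 b with hc
  have hc0 : c 0 = a := by simp [hc]
  have hc1 : c 1 = b := by simp [hc]
  have hmc : m ≤ c := by
    rw [Finsupp.le_def, Fin.forall_fin_two]
    omega
  have hu : coeff m f ≠ 0 := mem_support_iff.mp hm
  have hrem : monomial (c - m) (coeff m f)⁻¹ * f - monomial c 1 ∈ I := by
    refine hle (mem_span_X_pow_pair_iff.mpr fun d hd ↦ ?_)
    by_contra! hlt
    rw [mem_support_iff, coeff_sub, coeff_monomial_mul', coeff_monomial] at hd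
    by_cases hdc : c = d
    · subst hdc
      simp [tsub_tsub_cancel_of_le hmc, hu] at hd
    · rw [if_neg hdc, sub_zero] at hd
      obtain ⟨hle', hd⟩ := ite_ne_right_iff.mp hd
      have h0 := hle' 0
      have h1 := hle' 1
      have hm0 := hmc 0
      have hm1 := hmc 1
      simp only [Finsupp.tsub_apply] at h0 h1
      have hsub : d - (c - m) ≤ m := by
        rw [Finsupp.le_def, Fin.forall_fin_two]
        simp only [Finsupp.tsub_apply]
        omega
      have hge := hmin ⟨mem_support_iff.mpr (right_ne_zero_of_mul hd),
        (hsub 0).trans_lt hma, (hsub 1).trans_lt hmb⟩ hsub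
      have g0 := hge 0
      have g1 := hge 1
      simp only [Finsupp.tsub_apply] at g0 g1
      refine hdc (Finsupp.ext (Fin.forall_fin_two.mpr ?_))
      omega
  exact (Submodule.sub_mem_iff_right I (I.mul_mem_left _ hfI)).mp hrem

lemma infIrred_span_X_pow_pair {k : Type*} [Field k] {a b : ℕ} (ha : a ≠ 0) (hb : b ≠ 0) :
    InfIrred (Ideal.span {(X 0 : MvPolynomial (Fin 2) k) ^ a,
      (X 1 : MvPolynomial (Fin 2) k) ^ b}) := by
  obtain ⟨a, rfl⟩ := Nat.exists_eq_succ_of_ne_zero ha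
  obtain ⟨b, rfl⟩ := Nat.exists_eq_succ_of_ne_zero hb
  have hnot : monomial (Finsupp.single 0 a + Finsupp.single 1 b) (1 : k) ∉
      Ideal.span {(X 0 : MvPolynomial (Fin 2) k) ^ (a + 1),
        (X 1 : MvPolynomial (Fin 2) k) ^ (b + 1)} := by
    rw [mem_span_X_pow_pair_iff]
    simp
  refine ⟨fun hmax ↦ hnot (isMax_iff_eq_top.mp hmax ▸ Submodule.mem_top), fun I J hIJ ↦ ?_⟩
  by_contra! hne
  have hI := monomial_mem_of_span_X_pow_pair_lt
    ((hIJ.symm.le.trans inf_le_left).lt_of_ne hne.1.symm)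
  have hJ := monomial_mem_of_span_X_pow_pair_lt
    ((hIJ.symm.le.trans inf_le_right).lt_of_ne hne.2.symm)
  exact hnot (hIJ ▸ ⟨hI, hJ⟩)

end MvPolynomial

/-- Let `k` be a field and `n ≥ 1`. In the polynomial ring `k[s,t]`, the
ideal `(s,t)^n` admits the irreducible decomposition
`(s,t)^n = ⋂_{i=1}^{n} (s^i, t^{n+1−i})`; moreover each ideal `(s^i, t^{n+1−i})` is
irreducible (i.e. inf-irreducible in the lattice of ideals). -/
theorem pow_ideal_st_irreducible_decomposition
    (k : Type*) [Field k] (n : ℕ) (hn : 1 ≤ n) :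
    ((Ideal.span {X 0, X 1} : Ideal (MvPolynomial (Fin 2) k)) ^ n =
        ⨅ i ∈ Finset.Icc 1 n,
          Ideal.span {(X 0 : MvPolynomial (Fin 2) k) ^ i, (X 1 : MvPolynomial (Fin 2) k) ^ (n + 1 - i)}) ∧
      ∀ i ∈ Finset.Icc 1 n,
        InfIrred (Ideal.span {(X 0 : MvPolynomial (Fin 2) k) ^ i,
          (X 1 : MvPolynomial (Fin 2) k) ^ (n + 1 - i)}) := by
  refine ⟨?_, fun i hi ↦ ?_⟩
  · ext p
    simp only [Submodule.mem_iInf, mem_span_X_pair_pow_iff, mem_span_X_pow_pair_iff,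
      Finset.mem_Icc]
    refine ⟨fun h i hi m hm ↦ ?_, fun h m hm ↦ ?_⟩
    · have := h m hm
      omega
    · by_contra! hlt
      have := h (m 0 + 1) (by omega) m hm
      omega
  · rw [Finset.mem_Icc] at hi
    exact infIrred_span_X_pow_pair (by omega) (by omega)
end
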